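/- arXiv:1010.1536 — 4 statements merged into one kernel-verified Lean document; each statement's English description precedes it below -/
import Mathlib

section
/- Let (R, 𝔪) be a Cohen-Macaulay Noetherian local ring of Krull dimension d and let M be a nonzero finitely generated Cohen-Macaulay R-module (i.e. depth_R M = dim_R M). Set g := d − dim_R M and suppose that Ext^i_R(M, R) = 0 for all i ≠ g (this holds whenever M has finite G-dimension, since then the G-dimension equals the grade g). Then Ext^g_R(M, R) is a Cohen-Macaulay R-module of dimension d − g, i.e. depth_R Ext^g_R(M,R) = dim_R Ext^g_R(M,R) = d − g. In particular, M is CME. -/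
open CategoryTheory Opposite IsLocalRing

/-- The Ext module `Ext^i_R(M, N)` as an object of `ModuleCat R`. -/
noncomputable def extMod (R : Type) [CommRing R] (M N : Type) [AddCommGroup M] [Module R M]
    [AddCommGroup N] [Module R N] (i : ℕ) : ModuleCat R :=
  ((Ext R (ModuleCat R) i).obj (op (ModuleCat.of R M))).obj (ModuleCat.of R N)

/-- The Tor module `Tor_i^R(M, N)` as an object of `ModuleCat R`. -/
noncomputable def torMod (R : Type) [CommRing R] (M N : Type) [AddCommGroup M] [Module R M]
    [AddCommGroup N] [Module R N] (i : ℕ) : ModuleCat R :=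
  ((Tor (ModuleCat R) i).obj (ModuleCat.of R M)).obj (ModuleCat.of R N)

/-- The depth of a module over a Noetherian local ring: the least `i` such that
`Ext^i_R(k, M) ≠ 0`, with the convention `depth 0 = ⊤` (as `sInf ∅ = ⊤` in `ℕ∞`). -/
noncomputable def rdepth (R : Type) [CommRing R] [IsLocalRing R] (M : Type) [AddCommGroup M]
    [Module R M] : ℕ∞ :=
  sInf {n : ℕ∞ | ∃ i : ℕ, Nontrivial (extMod R (ResidueField R) M i) ∧ n = i}

/-- The Krull dimension of a module: `dim R⧸Ann M`. -/
noncomputable def mdim (R : Type) [CommRing R] (M : Type) [AddCommGroup M] [Module R M] :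
    WithBot ℕ∞ :=
  ringKrullDim (R ⧸ Module.annihilator R M)

/-- `M` is Cohen-Macaulay of dimension `n`: depth and dimension both equal `n`. -/
def isCMofDim (R : Type) [CommRing R] [IsLocalRing R] (M : Type) [AddCommGroup M] [Module R M]
    (n : ℕ) : Prop :=
  rdepth R M = (n : ℕ∞) ∧ mdim R M = (n : ℕ)

/-- `M` is Cohen-Macaulay: depth equals dimension. -/
def isCM (R : Type) [CommRing R] [IsLocalRing R] (M : Type) [AddCommGroup M] [Module R M] : Prop :=
  (rdepth R M : WithBot ℕ∞) = mdim R M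

/-- `R` is a Cohen-Macaulay local ring of dimension `d`. -/
def isCMLocalRing (R : Type) [CommRing R] [IsLocalRing R] (d : ℕ) : Prop :=
  ringKrullDim R = (d : ℕ) ∧ rdepth R R = (d : ℕ∞)

/-- `M` has Sliding Depth of Extension modules: for `1 ≤ i ≤ d-1`, either `Ext^i(M,R) = 0`
or `depth Ext^i(M,R) ≥ d - i`. -/
def isSDE (R : Type) [CommRing R] [IsLocalRing R] (M : Type) [AddCommGroup M] [Module R M]
    (d : ℕ) : Prop :=
  ∀ i : ℕ, 1 ≤ i → i ≤ d - 1 →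
    Subsingleton (extMod R M R i) ∨ ((d - i : ℕ) : ℕ∞) ≤ rdepth R (extMod R M R i)

/-- `M` has Cohen-Macaulay Extension modules: for `1 ≤ i ≤ d-1`, either `Ext^i(M,R) = 0`
or `Ext^i(M,R)` is Cohen-Macaulay of dimension `d - i`. -/
def isCME (R : Type) [CommRing R] [IsLocalRing R] (M : Type) [AddCommGroup M] [Module R M]
    (d : ℕ) : Prop :=
  ∀ i : ℕ, 1 ≤ i → i ≤ d - 1 →
    Subsingleton (extMod R M R i) ∨ isCMofDim R (extMod R M R i) (d - i)

/-- `M` is sequentially Cohen-Macaulay: it has a filtration with Cohen-Macaulay quotients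
of strictly increasing dimensions. -/
def isSeqCM (R : Type) [CommRing R] [IsLocalRing R] (M : Type) [AddCommGroup M] [Module R M] :
    Prop :=
  ∃ (r : ℕ) (Φ : Fin (r + 1) → Submodule R M), Φ 0 = ⊥ ∧ Φ (Fin.last r) = ⊤ ∧ StrictMono Φ ∧
    (∀ i : Fin r, isCM R (↥(Φ i.succ) ⧸ (Φ i.castSucc).comap (Φ i.succ).subtype)) ∧
    (∀ i j : Fin r, i < j →
      mdim R (↥(Φ i.succ) ⧸ (Φ i.castSucc).comap (Φ i.succ).subtype) <
      mdim R (↥(Φ j.succ) ⧸ (Φ j.castSucc).comap (Φ j.succ).subtype))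

/-- `ω` is a canonical module of the `d`-dimensional local ring `R`:
`Ext^i_R(k, ω) = 0` for `i ≠ d` and `Ext^d_R(k, ω) ≅ k`. -/
def isCanonicalModule (R : Type) [CommRing R] [IsLocalRing R] (d : ℕ) (ω : Type)
    [AddCommGroup ω] [Module R ω] : Prop :=
  Module.Finite R ω ∧ (∀ i : ℕ, i ≠ d → Subsingleton (extMod R (ResidueField R) ω i)) ∧
    Nonempty ((extMod R (ResidueField R) ω d) ≃ₗ[R] ResidueField R)

/-- The local cohomology module `H^i_𝔪(M)` supported at the maximal ideal. -/
noncomputable def lcMod (R : Type) [CommRing R] [IsLocalRing R] (i : ℕ) (M : Type)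
    [AddCommGroup M] [Module R M] : ModuleCat R :=
  (localCohomology (maximalIdeal R) i).obj (ModuleCat.of R M)

/-- The 𝔪-torsion submodule `Γ_𝔪(M) = {x ∈ M | 𝔪^n x = 0 for some n}`. -/
noncomputable def mTorsion (R : Type) [CommRing R] [IsLocalRing R] (M : Type) [AddCommGroup M]
    [Module R M] : Submodule R M :=
  ⨆ n : ℕ, Submodule.torsionBySet R M ((maximalIdeal R ^ n : Ideal R) : Set R)

/-- The natural evaluation (biduality) map `M → Hom_R(Hom_R(M, ω), ω)`. -/
noncomputable def evMap (R : Type) [CommRing R] (M ω : Type) [AddCommGroup M] [Module R M]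
    [AddCommGroup ω] [Module R ω] : M →ₗ[R] ((M →ₗ[R] ω) →ₗ[R] ω) :=
  (LinearMap.id : (M →ₗ[R] ω) →ₗ[R] (M →ₗ[R] ω)).flip

/-- Serre's condition `(S₂)` on the punctured spectrum. -/
def serreS2Punctured (R : Type) [CommRing R] [IsLocalRing R] (M : Type) [AddCommGroup M]
    [Module R M] : Prop :=
  ∀ (𝔭 : Ideal R) [𝔭.IsPrime], 𝔭 ≠ maximalIdeal R →
    min (2 : WithBot ℕ∞) (mdim (Localization.AtPrime 𝔭) (LocalizedModule 𝔭.primeCompl M)) ≤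
      (rdepth (Localization.AtPrime 𝔭) (LocalizedModule 𝔭.primeCompl M) : WithBot ℕ∞)

namespace CategoryTheory.ProjectiveResolution

universe w v u t

variable {C : Type u} [Category.{v} C] [Abelian C] [HasExt.{w} C]
  {X Y : C} (P : ProjectiveResolution X)

lemma extMk_zero_eq_zero_iff (f : P.complex.X 0 ⟶ Y) (hf : P.complex.d 1 0 ≫ f = 0) :
    P.extMk f 1 (zero_add 1) hf = 0 ↔ f = 0 := by
  rw [← P.extEquivCohomologyClass.apply_eq_iff_eq,
    extEquivCohomologyClass_extMk, extEquivCohomologyClass_zero,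
    CochainComplex.HomComplex.CohomologyClass.mk_eq_zero_iff,
    CochainComplex.HomComplex.Cocycle.toSingleMk_mem_coboundaries_iff _ _ _ _ _ 1 (by simp)]
  have h : P.cochainComplex.d (-(0 : ℕ) : ℤ) 1 = 0 :=
    (CochainComplex.isZero_of_isStrictlyLE P.cochainComplex 0 1).eq_of_tgt _ _
  simp only [h, Limits.zero_comp]
  rw [← cancel_epi (P.cochainComplexXIso (-(0 : ℕ)) 0 rfl).hom, Limits.comp_zero]
  exact ⟨fun ⟨_, h⟩ ↦ h.symm, fun h ↦ ⟨0, h.symm⟩⟩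

variable (Y) (k : Type t) [Ring k] [Linear k C] (n : ℕ)

variable {Y n} in
lemma smul_extMk (r : k) (f : P.complex.X n ⟶ Y) (m : ℕ) (hm : n + 1 = m)
    (hf : P.complex.d m n ≫ f = 0) :
    r • P.extMk f m hm hf = P.extMk (r • f) m hm (by simp [hf]) := by
  rw [Abelian.Ext.smul_eq_comp_mk₀, extMk_comp_mk₀]
  simp

/-- The linear map from degree `n` cocycles on a projective resolution to `Ext`. -/
noncomputable def extMkLinear :
    LinearMap.ker (Linear.leftComp k Y (P.complex.d (n + 1) n)) →ₗ[k] Abelian.Ext X Y n where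
  toFun f := P.extMk f.1 (n + 1) rfl f.2
  map_add' _ _ := (P.add_extMk ..).symm
  map_smul' r f := (P.smul_extMk k r f.1 _ rfl f.2).symm

lemma extMkLinear_surjective : Function.Surjective (P.extMkLinear Y k n) := fun e ↦ by
  obtain ⟨f, hf, rfl⟩ := P.extMk_surjective e (n + 1) rfl
  exact ⟨⟨f, hf⟩, rfl⟩

lemma mem_ker_extMkLinear_iff
    (f : LinearMap.ker (Linear.leftComp k Y (P.complex.d (n + 1) n))) :
    f ∈ LinearMap.ker (P.extMkLinear Y k n) ↔
      f.1 ∈ LinearMap.range (Linear.leftComp k Y (P.complex.d n ((ComplexShape.up ℕ).prev n))) := by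
  rcases n with - | n
  · refine (P.extMk_zero_eq_zero_iff f.1 f.2).trans ?_
    have h₁ : Linear.leftComp k Y (P.complex.d 0 ((ComplexShape.up ℕ).prev 0)) = 0 := by
      ext g
      simp
    simp only [h₁, LinearMap.range_zero, Submodule.mem_bot]
  · refine (P.extMk_eq_zero_iff f.1 _ rfl f.2 _ ?_)
    simp

/-- The `Ext` modules defined by left deriving `Hom` agree with those defined by means of the
derived category. -/
noncomputable def extLinearEquiv [EnoughProjectives C] :
    ((Ext k C n).obj (op X)).obj Y ≃ₗ[k] Abelian.Ext X Y n := by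
  let S := (P.complex.linearYonedaObj k Y).sc' ((ComplexShape.up ℕ).prev n) n (n + 1)
  let e : ((Ext k C n).obj (op X)).obj Y ≅ S.moduleCatLeftHomologyData.H :=
    P.isoExt n Y ≪≫ HomologicalComplex.homologyIsoSc' _ _ _ _ rfl (by simp) ≪≫
      S.moduleCatHomologyIso
  have h : LinearMap.range S.moduleCatToCycles = LinearMap.ker (P.extMkLinear Y k n) := by
    ext f
    refine Iff.trans ⟨?_, ?_⟩ (P.mem_ker_extMkLinear_iff Y k n f).symm
    · rintro ⟨g, rfl⟩
      exact ⟨g, rfl⟩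
    · rintro ⟨g, hg⟩
      exact ⟨g, Subtype.ext hg⟩
  let e' : S.moduleCatLeftHomologyData.H ≃ₗ[k]
      LinearMap.ker (Linear.leftComp k Y (P.complex.d (n + 1) n)) ⧸
        LinearMap.ker (P.extMkLinear Y k n) :=
    Submodule.quotEquivOfEq _ _ h
  exact e.toLinearEquiv ≪≫ₗ e' ≪≫ₗ
    (P.extMkLinear Y k n).quotKerEquivOfSurjective (P.extMkLinear_surjective Y k n)

end CategoryTheory.ProjectiveResolution

namespace ModuleCat

open RingTheory.Sequence Module Pointwise

universe u

lemma eq_natCast_of_add_one_eq {a : WithBot ℕ∞} {n : ℕ} (h : a + 1 = (n + 1 : ℕ)) : a = n := by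
  induction a using WithBot.recBotCoe with
  | bot => exact absurd h.symm (WithBot.coe_ne_bot (a := ((n + 1 : ℕ) : ℕ∞)))
  | coe a =>
    have h : a + 1 = (n + 1 : ℕ) := by exact_mod_cast h
    refine congr_arg WithBot.some (a₂ := (n : ℕ∞)) ?_
    exact ENat.add_left_injective_of_ne_top ENat.one_ne_top (by simpa using h)

variable {R : Type u} [CommRing R]

/-- Multiplication by `x` on `M`, seen through `Ext(-, N)`, is multiplication by `x`. -/
lemma mk₀_smulShortComplex_f_comp {M N : ModuleCat.{u} R} (x : R) {i : ℕ}
    (e : Abelian.Ext M N i) :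
    (Abelian.Ext.mk₀ (M.smulShortComplex x).f).comp e (zero_add i) = x • e := by
  change (Abelian.Ext.mk₀ (x • 𝟙 M)).comp e (zero_add i) = x • e
  simp [Abelian.Ext.mk₀_smul]

lemma annihilator_le_annihilator_ext (M N : ModuleCat.{u} R) (i : ℕ) :
    annihilator R M ≤ annihilator R (Abelian.Ext M N i) := fun r hr ↦ by
  refine mem_annihilator.mpr fun e ↦ ?_
  rw [Abelian.Ext.smul_eq_comp_mk₀]
  exact DFunLike.congr_fun (congr_arg AddCommGrpCat.Hom.hom
    (Abelian.Ext.postcomp_smul_id_eq_zero_of_mem_annihilator (M := N) hr i)) e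

section Regular

variable {M N : ModuleCat.{u} R} {x : R} (hx : IsSMulRegular M x)
include hx

lemma isSMulRegular_ext_of_subsingleton_ext_quotSMulTop {i : ℕ}
    [Subsingleton (Abelian.Ext (ModuleCat.of R (QuotSMulTop x M)) N i)] :
    IsSMulRegular (Abelian.Ext M N i) x := by
  refine (isSMulRegular_iff_right_eq_zero_of_smul).mpr fun e he ↦ ?_
  obtain ⟨f, rfl⟩ := Abelian.Ext.contravariant_sequence_exact₂ hx.smulShortComplex_shortExact N e
    ((mk₀_smulShortComplex_f_comp x e).trans he)
  rw [Subsingleton.elim (α := Abelian.Ext (ModuleCat.of R (QuotSMulTop x M)) N i) f 0]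
  exact Abelian.Ext.comp_zero ..

lemma smul_surjective_ext_of_subsingleton_ext_quotSMulTop {i : ℕ}
    [Subsingleton (Abelian.Ext (ModuleCat.of R (QuotSMulTop x M)) N (i + 1))]
    (e : Abelian.Ext M N i) :
    ∃ f : Abelian.Ext M N i, x • f = e := by
  obtain ⟨f, hf⟩ := Abelian.Ext.contravariant_sequence_exact₁ hx.smulShortComplex_shortExact N e
    (add_comm 1 i) (Subsingleton.elim
      (α := Abelian.Ext (ModuleCat.of R (QuotSMulTop x M)) N (i + 1)) _ _)
  exact ⟨f, (mk₀_smulShortComplex_f_comp x f).symm.trans hf⟩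

lemma subsingleton_ext_quotSMulTop_of_subsingleton_ext {i : ℕ}
    [Subsingleton (Abelian.Ext M N i)] [Subsingleton (Abelian.Ext M N (i + 1))] :
    Subsingleton (Abelian.Ext (ModuleCat.of R (QuotSMulTop x M)) N (i + 1)) := by
  refine subsingleton_of_forall_eq 0 fun e ↦ ?_
  obtain ⟨f, rfl⟩ := Abelian.Ext.contravariant_sequence_exact₃ hx.smulShortComplex_shortExact N e
    (Subsingleton.elim (α := Abelian.Ext M N (i + 1)) _ _) (add_comm 1 i)
  rw [Subsingleton.elim (α := Abelian.Ext M N i) f 0]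
  exact Abelian.Ext.comp_zero ..

/-- If `x` is `M`-regular and `Ext^{i+1}(M, N) = 0`, then
`Ext^i(M, N) ⧸ x Ext^i(M, N) ≃ Ext^{i+1}(M ⧸ xM, N)`. -/
noncomputable def quotSMulTopExtEquiv {i : ℕ} [Subsingleton (Abelian.Ext M N (i + 1))] :
    QuotSMulTop x (Abelian.Ext M N i) ≃ₗ[R]
      Abelian.Ext (ModuleCat.of R (QuotSMulTop x M)) N (i + 1) := by
  let δ : Abelian.Ext M N i →ₗ[R] Abelian.Ext (ModuleCat.of R (QuotSMulTop x M)) N (i + 1) :=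
    hx.smulShortComplex_shortExact.extClass.precompOfLinear R N (add_comm 1 i)
  refine Submodule.quotEquivOfEq _ _ ?_ ≪≫ₗ δ.quotKerEquivOfSurjective fun e ↦
    Abelian.Ext.contravariant_sequence_exact₃ hx.smulShortComplex_shortExact N e
      (Subsingleton.elim (α := Abelian.Ext M N (i + 1)) _ _) (add_comm 1 i)
  ext e
  rw [Submodule.mem_smul_pointwise_iff_exists, LinearMap.mem_ker]
  constructor
  · rintro ⟨f, -, rfl⟩
    rw [← mk₀_smulShortComplex_f_comp]
    exact hx.smulShortComplex_shortExact.extClass_comp_assoc f (h := add_comm 1 i)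
  · intro he
    obtain ⟨f, hf⟩ := Abelian.Ext.contravariant_sequence_exact₁ hx.smulShortComplex_shortExact N e
      (add_comm 1 i) he
    exact ⟨f, trivial, (mk₀_smulShortComplex_f_comp x f).symm.trans hf⟩

end Regular

variable [IsNoetherianRing R] [IsLocalRing R]

omit [IsNoetherianRing R] in
lemma _root_.RingTheory.Sequence.IsRegular.mem_maximalIdeal {M : Type*} [AddCommGroup M]
    [Module R M] {rs : List R} (h : IsRegular M rs) {r : R} (hr : r ∈ rs) :
    r ∈ maximalIdeal R := by
  by_contra hr'
  rw [IsLocalRing.mem_maximalIdeal, mem_nonunits_iff, not_not] at hr'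
  refine h.top_ne_smul ?_
  rw [Ideal.eq_top_of_isUnit_mem (Ideal.ofList rs) (Ideal.subset_span hr) hr', Submodule.top_smul]

omit [IsNoetherianRing R] in
lemma maximalIdeal_smul_top_lt {M : Type*} [AddCommGroup M] [Module R M] [Module.Finite R M]
    [Nontrivial M] : maximalIdeal R • (⊤ : Submodule R M) < ⊤ :=
  lt_top_iff_ne_top.mpr (Submodule.top_ne_ideal_smul_of_le_jacobson_annihilator
    (maximalIdeal_le_jacobson _)).symm

lemma length_le_of_isRegular {M : Type*} [AddCommGroup M]
    [Module R M] [Module.Finite R M] {rs : List R} (h : IsRegular M rs) :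
    (rs.length : WithBot ℕ∞) ≤ supportDim R M := by
  have h₁ := supportDim_add_length_eq_supportDim_of_isRegular rs h
  have h₂ : supportDim R (M ⧸ Ideal.ofList rs • (⊤ : Submodule R M)) ≠ ⊥ :=
    (supportDim_ne_bot_iff_nontrivial R _).mpr <|
      Submodule.Quotient.nontrivial_iff.mpr h.top_ne_smul.symm
  rw [← h₁]
  refine le_add_of_nonneg_left ?_
  rw [← WithBot.coe_unbot _ h₂]
  exact WithBot.coe_le_coe.mpr zero_le

/-- A Cohen-Macaulay module of dimension `n` satisfies `Ext^i(M, N) = 0` for `i < depth N - n`. -/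
theorem subsingleton_ext_of_add_length_lt {N : ModuleCat.{u} R} [Module.Finite R N]
    {ss : List R} (hss : IsRegular N ss) {rs : List R} {M : ModuleCat.{u} R} [Module.Finite R M]
    (hrs : IsRegular M rs) (hdim : supportDim R M = rs.length) {i : ℕ}
    (hi : i + rs.length < ss.length) : Subsingleton (Abelian.Ext M N i) := by
  induction rs generalizing M i with
  | nil =>
    have := hss.nontrivial
    refine subsingleton_ext_of_exists_isRegular (maximalIdeal R) M
      (support_of_supportDim_eq_zero R M (by simpa using hdim)).subset N maximalIdeal_smul_top_lt ss
      (fun _ ↦ hss.mem_maximalIdeal) hss i (by simpa using hi)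
  | cons x rs ih =>
    have hx := hrs.mem_maximalIdeal List.mem_cons_self
    rw [isRegular_cons_iff] at hrs
    have hd : supportDim R (QuotSMulTop x M) = rs.length := eq_natCast_of_add_one_eq <|
      (supportDim_quotSMulTop_succ_eq_supportDim hrs.1 hx).trans hdim
    have := ih (M := ModuleCat.of R (QuotSMulTop x M)) hrs.2 hd (i := i + 1) (by simp at hi; omega)
    have := smul_surjective_ext_of_subsingleton_ext_quotSMulTop (N := N) hrs.1 (i := i)
    by_contra h
    rw [not_subsingleton_iff_nontrivial] at h
    refine Submodule.top_ne_pointwise_smul_of_mem_jacobson_annihilator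
      (M := Abelian.Ext M N i) (maximalIdeal_le_jacobson (R := R) _ hx) ?_
    refine (Submodule.eq_top_iff'.mpr fun e ↦ ?_).symm
    obtain ⟨f, rfl⟩ := this e
    exact Submodule.smul_mem_pointwise_smul _ _ _ trivial

/-- If `N` and `M` are Cohen-Macaulay and `Ext^i(M, N)` vanishes for `i ≠ g = dim N - dim M`, then
a maximal `M`-regular sequence is `Ext^g(M, N)`-regular, and `dim Ext^g(M, N) = dim M`. -/
theorem isRegular_ext_of_subsingleton_ext {N : ModuleCat.{u} R} [Module.Finite R N]
    {ss : List R} (hss : IsRegular N ss) (hN : supportDim R N = ss.length)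
    {rs : List R} {M : ModuleCat.{u} R} [Module.Finite R M]
    (hrs : IsRegular M rs) (hdim : supportDim R M = rs.length) {g : ℕ}
    (hg : g + rs.length = ss.length) (hext : ∀ i ≠ g, Subsingleton (Abelian.Ext M N i)) :
    IsRegular (Abelian.Ext M N g) rs ∧ supportDim R (Abelian.Ext M N g) = rs.length := by
  induction rs generalizing M g with
  | nil =>
    have := hss.nontrivial
    have hM := support_of_supportDim_eq_zero R M (by simpa using hdim)
    have hE : Nontrivial (Abelian.Ext M N g) := by
      by_contra hE
      rw [not_nontrivial_iff_subsingleton] at hE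
      obtain ⟨ts, hl, -, hts⟩ := exists_isRegular_of_exists_subsingleton_ext (maximalIdeal R)
        (ss.length + 1) N maximalIdeal_smul_top_lt M hM
        fun i _ ↦ if h : i = g then h ▸ hE else hext i h
      have := length_le_of_isRegular hts
      rw [hl, hN] at this
      have : ss.length + 1 ≤ ss.length := by exact_mod_cast this
      omega
    have hnil := IsRegular.nil R (Abelian.Ext M N g)
    refine ⟨hnil, le_antisymm ?_ (length_le_of_isRegular hnil)⟩
    rw [← hdim, supportDim_eq_ringKrullDim_quotient_annihilator,
      supportDim_eq_ringKrullDim_quotient_annihilator]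
    exact ringKrullDim_le_of_surjective
      (Ideal.Quotient.factor (annihilator_le_annihilator_ext M N g))
      (Ideal.Quotient.factor_surjective _)
  | cons x rs ih =>
    have hx := hrs.mem_maximalIdeal List.mem_cons_self
    rw [isRegular_cons_iff] at hrs
    have hd : supportDim R (QuotSMulTop x M) = rs.length := eq_natCast_of_add_one_eq <|
      (supportDim_quotSMulTop_succ_eq_supportDim hrs.1 hx).trans hdim
    rw [List.length_cons] at hg
    have := hext (g + 1) (by omega)
    have := subsingleton_ext_of_add_length_lt (M := ModuleCat.of R (QuotSMulTop x M)) hss hrs.2 hd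
      (i := g) (by omega)
    obtain ⟨h₁, h₂⟩ := ih (M := ModuleCat.of R (QuotSMulTop x M)) hrs.2 hd (g := g + 1)
        (by omega) <| by
      intro i hi
      rcases i with - | i
      · apply subsingleton_ext_of_add_length_lt (M := ModuleCat.of R (QuotSMulTop x M)) hss hrs.2 hd
        omega
      · rcases eq_or_ne i g with rfl | h
        · omega
        rcases eq_or_ne (i + 1) g with rfl | h'
        · assumption
        have := hext i h
        have := hext (i + 1) h'
        exact subsingleton_ext_quotSMulTop_of_subsingleton_ext hrs.1
    have hreg : IsSMulRegular (Abelian.Ext M N g) x :=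
      isSMulRegular_ext_of_subsingleton_ext_quotSMulTop hrs.1
    let e := quotSMulTopExtEquiv (N := N) hrs.1 (i := g)
    refine ⟨(isRegular_cons_iff _ _ _).mpr ⟨hreg, (e.isRegular_congr rs).mpr h₁⟩, ?_⟩
    rw [← supportDim_quotSMulTop_succ_eq_supportDim hreg hx, supportDim_eq_of_equiv e, h₂]
    simp

end ModuleCat

section

open RingTheory.Sequence

/-- `extMod` is the `Ext` module defined by means of the derived category. -/
noncomputable def extModEquiv (R : Type) [CommRing R] (M N : Type) [AddCommGroup M] [Module R M]
    [AddCommGroup N] [Module R N] (i : ℕ) :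
    extMod R M N i ≃ₗ[R] Abelian.Ext (ModuleCat.of R M) (ModuleCat.of R N) i :=
  (projectiveResolution (ModuleCat.of R M)).extLinearEquiv (ModuleCat.of R N) R i

variable {R : Type} [CommRing R] [IsNoetherianRing R] [IsLocalRing R]
  {M : Type} [AddCommGroup M] [Module R M] [Module.Finite R M]

omit [IsNoetherianRing R] [IsLocalRing R] in
lemma mdim_eq_supportDim : mdim R M = Module.supportDim R M :=
  (Module.supportDim_eq_ringKrullDim_quotient_annihilator R M).symm

lemma natCast_le_rdepth_iff [Nontrivial M] {n : ℕ} :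
    (n : ℕ∞) ≤ rdepth R M ↔ ∃ rs : List R, rs.length = n ∧ IsRegular M rs := by
  have hk : Module.support R (ResidueField R) = PrimeSpectrum.zeroLocus (maximalIdeal R) := by
    rw [Module.support_eq_zeroLocus]
    exact congr_arg _ (congr_arg _ Ideal.annihilator_quotient)
  have h : (n : ℕ∞) ≤ rdepth R M ↔ ∀ i < n, Subsingleton
      (Abelian.Ext (ModuleCat.of R (ResidueField R)) (ModuleCat.of R M) i) := by
    rw [rdepth, le_sInf_iff]
    constructor
    · intro h i hi
      by_contra hn
      rw [not_subsingleton_iff_nontrivial] at hn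
      have := h i ⟨i, (extModEquiv R (ResidueField R) M i).toEquiv.nontrivial, rfl⟩
      exact hi.not_ge (by exact_mod_cast this)
    · rintro h _ ⟨i, hi, rfl⟩
      by_contra hn
      have := h i (by simpa using hn)
      exact not_subsingleton _ ((extModEquiv R (ResidueField R) M i).toEquiv.subsingleton)
  rw [h]
  constructor
  · intro h
    obtain ⟨rs, hl, -, hrs⟩ := ModuleCat.exists_isRegular_of_exists_subsingleton_ext
      (maximalIdeal R) n (ModuleCat.of R M) ModuleCat.maximalIdeal_smul_top_lt
      (ModuleCat.of R (ResidueField R)) hk h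
    exact ⟨rs, hl, hrs⟩
  · rintro ⟨rs, rfl, hrs⟩
    exact ModuleCat.subsingleton_ext_of_exists_isRegular (maximalIdeal R)
      (ModuleCat.of R (ResidueField R)) hk.subset (ModuleCat.of R M)
      ModuleCat.maximalIdeal_smul_top_lt rs (fun _ ↦ hrs.mem_maximalIdeal) hrs

lemma isCMofDim_of_isRegular {rs : List R} (hrs : IsRegular M rs)
    (hdim : Module.supportDim R M = rs.length) : isCMofDim R M rs.length := by
  have := hrs.nontrivial
  refine ⟨le_antisymm ?_ (natCast_le_rdepth_iff.mpr ⟨rs, rfl, hrs⟩), mdim_eq_supportDim.trans hdim⟩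
  refine ENat.lt_natCast_add_one_iff.mp (lt_of_not_ge fun h ↦ ?_)
  obtain ⟨ts, hl, hts⟩ := (natCast_le_rdepth_iff (n := rs.length + 1)).mp (by exact_mod_cast h)
  have := ModuleCat.length_le_of_isRegular hts
  rw [hl, hdim] at this
  have : rs.length + 1 ≤ rs.length := by exact_mod_cast this
  omega

end

/-- Over a Cohen-Macaulay Noetherian local ring `R` of dimension `d`, if `M` is
a nonzero finitely generated Cohen-Macaulay module, `g = d - dim M`, and `Ext^i_R(M,R) = 0` for
all `i ≠ g`, then `Ext^g_R(M,R)` is Cohen-Macaulay of dimension `d - g`; in particular `M` is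
CME. -/
theorem statement0 (R : Type) [CommRing R] [IsNoetherianRing R] [IsLocalRing R]
    (d : ℕ) (hR : isCMLocalRing R d)
    (M : Type) [AddCommGroup M] [Module R M] [Module.Finite R M] [Nontrivial M]
    (hCM : isCM R M)
    (dimM g : ℕ) (hdimM : mdim R M = (dimM : ℕ)) (hg : g = d - dimM)
    (hvan : ∀ i : ℕ, i ≠ g → Subsingleton (extMod R M R i)) :
    isCMofDim R (extMod R M R g) (d - g) ∧ isCME R M d := by
  obtain ⟨ss, hl, hss⟩ := natCast_le_rdepth_iff.mp hR.2.ge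
  have hsd : Module.supportDim R R = ss.length := by
    rw [Module.supportDim_self_eq_ringKrullDim, hR.1, hl]
  have hdep : rdepth R M = dimM := WithBot.coe_injective (hCM.trans hdimM)
  obtain ⟨rs, hl', hrs⟩ := natCast_le_rdepth_iff.mp hdep.ge
  have hd : Module.supportDim R M = rs.length := by rw [← mdim_eq_supportDim, hdimM, hl']
  have hle : rs.length ≤ ss.length := by
    have := Module.supportDim_le_ringKrullDim R M
    rw [hd, hR.1, ← hl] at this
    exact_mod_cast this
  obtain ⟨h₁, h₂⟩ := ModuleCat.isRegular_ext_of_subsingleton_ext (N := ModuleCat.of R R)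
    (M := ModuleCat.of R M) hss hsd hrs hd (g := g) (by omega)
    fun i hi ↦ have := hvan i hi; (extModEquiv R M R i).symm.toEquiv.subsingleton
  let e := extModEquiv R M R g
  have : Module.Finite R (extMod R M R g) := Module.Finite.equiv e.symm
  have hE : isCMofDim R (extMod R M R g) (d - g) := by
    rw [show d - g = rs.length by omega]
    exact isCMofDim_of_isRegular ((e.isRegular_congr rs).mpr h₁)
      ((Module.supportDim_eq_of_equiv e).trans h₂)
  refine ⟨hE, fun i _ _ ↦ ?_⟩
  rcases eq_or_ne i g with rfl | h
  · exact .inr hE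
  · exact .inl (hvan i h)
end

section
/- Let (R, 𝔪) be a Noetherian local ring of Krull dimension d, let M be a finitely generated SDE R-module, and let F₁ →f F₀ → M → 0 be a finite free presentation of M, so that λM := image(f* : Hom_R(F₀,R) → Hom_R(F₁,R)) realizes the Martsinkovsky–Strooker operator λ = ΩTr up to free direct summands. Then depth_R(λM) ≥ min{depth_R M, depth R}. -/
open CategoryTheory Opposite IsLocalRing

section ExtComparison

variable {R : Type} [CommRing R] {X : ModuleCat.{0} R} (P : ProjectiveResolution X)
  (Y : ModuleCat.{0} R) (n : ℕ)

lemma CategoryTheory.ProjectiveResolution.extMk_zero_degree_eq_zero_iff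
    (f : P.complex.X 0 ⟶ Y) (hf : P.complex.d 1 0 ≫ f = 0) :
    P.extMk f 1 rfl hf = 0 ↔ f = 0 := by
  refine ⟨fun h ↦ ?_, fun h ↦ by subst h; exact P.extMk_zero 1 rfl⟩
  rw [← P.extEquivCohomologyClass.apply_eq_iff_eq,
    P.extEquivCohomologyClass_extMk, P.extEquivCohomologyClass_zero,
    CochainComplex.HomComplex.CohomologyClass.mk_eq_zero_iff,
    CochainComplex.HomComplex.Cocycle.toSingleMk_mem_coboundaries_iff _ _ _ _ _ 1 (by lia)] at h
  obtain ⟨g, hg⟩ := h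
  have hz : g = 0 := (P.cochainComplex.isZero_of_isStrictlyLE 0 1 (by lia)).eq_of_src _ _
  rw [hz, Limits.comp_zero] at hg
  rw [← cancel_epi (P.cochainComplexXIso (-(0 : ℕ)) 0 rfl).hom, ← hg, Limits.comp_zero]

/-- The map sending an `n`-cocycle of `Hom(P, Y)` to its class in `Ext`. -/
noncomputable def cocycleToExt :
    LinearMap.ker ((P.complex.linearYonedaObj R Y).d n (n + 1)).hom →ₗ[R]
      Abelian.Ext X Y n where
  toFun f := P.extMk (f.1 : P.complex.X n ⟶ Y) (n + 1) rfl f.2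
  map_add' f g := (P.add_extMk _ _ _ _ _ _).symm
  map_smul' r f := by
    rw [RingHom.id_apply, Abelian.Ext.smul_eq_comp_mk₀]
    refine .trans ?_ (P.extMk_comp_mk₀ (f.1 : P.complex.X n ⟶ Y) _ _ _ _).symm
    congr 1

lemma cocycleToExt_surjective : Function.Surjective (cocycleToExt P Y n) := fun α ↦ by
  obtain ⟨f, hf, h⟩ := P.extMk_surjective α (n + 1) rfl
  exact ⟨⟨f, hf⟩, h⟩

lemma cocycleToExt_eq_zero_iff
    (f : LinearMap.ker ((P.complex.linearYonedaObj R Y).d n (n + 1)).hom) :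
    cocycleToExt P Y n f = 0 ↔
      ∃ g, (P.complex.linearYonedaObj R Y).d (n - 1) n g = f.1 := by
  obtain _ | n := n
  · refine (P.extMk_zero_degree_eq_zero_iff Y _ f.2).trans ?_
    rw [(P.complex.linearYonedaObj R Y).shape (0 - 1) 0 (by simp)]
    exact ⟨fun h ↦ ⟨0, h.symm⟩, fun ⟨_, h⟩ ↦ h.symm⟩
  · exact P.extMk_eq_zero_iff _ _ rfl f.2 n rfl

/-- The comparison between `Ext` as a derived functor and `Ext` in the derived category. -/
noncomputable def extObjLinearEquiv (X Y : ModuleCat.{0} R) (n : ℕ) :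
    ((Ext R (ModuleCat R) n).obj (op X)).obj Y ≃ₗ[R] Abelian.Ext X Y n :=
  let P := projectiveResolution X
  let K := P.complex.linearYonedaObj R Y
  let S := K.sc' (n - 1) n (n + 1)
  let Z := LinearMap.ker (K.d n (n + 1)).hom
  let e₁ : ((Ext R (ModuleCat R) n).obj (op X)).obj Y ≃ₗ[R]
      Z ⧸ LinearMap.range S.moduleCatToCycles :=
    (P.isoExt n Y ≪≫ K.homologyIsoSc' (n - 1) n (n + 1)
      (by obtain _ | n := n <;> simp) (by simp) ≪≫ S.moduleCatHomologyIso).toLinearEquiv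
  let e₂ : (Z ⧸ LinearMap.range S.moduleCatToCycles) ≃ₗ[R]
      Z ⧸ LinearMap.ker (cocycleToExt P Y n) :=
    Submodule.quotEquivOfEq _ _ (by
      ext f
      exact (LinearMap.mem_range.trans (exists_congr fun _ ↦ Subtype.ext_iff)).trans
        (cocycleToExt_eq_zero_iff P Y n f).symm)
  e₁ ≪≫ₗ e₂ ≪≫ₗ (cocycleToExt P Y n).quotKerEquivOfSurjective (cocycleToExt_surjective P Y n)

end ExtComparison

section ExtVanishing

variable {R : Type} [CommRing R]

lemma subsingleton_ext_of_linearEquiv {X Y Z : ModuleCat.{0} R} {n : ℕ} (e : Y ≃ₗ[R] Z)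
    (h : Subsingleton (Abelian.Ext X Y n)) : Subsingleton (Abelian.Ext X Z n) :=
  (((Abelian.extFunctorObj X n).mapIso e.toModuleIso).addCommGroupIsoToAddEquiv.toEquiv
    ).subsingleton_congr.mp h

lemma subsingleton_ext_of_subsingleton {X Y : ModuleCat.{0} R} {n : ℕ} [Subsingleton Y] :
    Subsingleton (Abelian.Ext X Y n) := by
  refine ⟨fun a b ↦ ?_⟩
  have h0 : 𝟙 Y = 0 := by ext; exact Subsingleton.elim _ _
  rw [← a.comp_mk₀_id, ← b.comp_mk₀_id, h0]
  simp

lemma subsingleton_ext_zero_iff {X Y : ModuleCat.{0} R} :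
    Subsingleton (Abelian.Ext X Y 0) ↔ Subsingleton (X →ₗ[R] Y) :=
  (Abelian.Ext.addEquiv₀.trans ModuleCat.homAddEquiv).toEquiv.subsingleton_congr

lemma subsingleton_ext_left_succ (X : ModuleCat.{0} R) {S : ShortComplex (ModuleCat.{0} R)}
    (hS : S.ShortExact) {n : ℕ} (h₃ : Subsingleton (Abelian.Ext X S.X₃ n))
    (h₂ : Subsingleton (Abelian.Ext X S.X₂ (n + 1))) :
    Subsingleton (Abelian.Ext X S.X₁ (n + 1)) := by
  refine subsingleton_of_forall_eq 0 fun x ↦ ?_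
  obtain ⟨y, rfl⟩ := Abelian.Ext.covariant_sequence_exact₁ X hS x (Subsingleton.elim _ _) rfl
  rw [Subsingleton.elim y 0, Abelian.Ext.zero_comp]

/-- For surjective `q : B → C`, `Ext^n(X, C) = 0` and `Ext^{n+1}(X, B) = 0` force
`Ext^{n+1}(X, ker q) = 0`. -/
lemma subsingleton_ext_ker_succ (X : ModuleCat.{0} R) {B C : Type} [AddCommGroup B] [Module R B]
    [AddCommGroup C] [Module R C] (q : B →ₗ[R] C) (hq : Function.Surjective q) {n : ℕ}
    (hC : Subsingleton (Abelian.Ext X (ModuleCat.of R C) n))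
    (hB : Subsingleton (Abelian.Ext X (ModuleCat.of R B) (n + 1))) :
    Subsingleton (Abelian.Ext X (ModuleCat.of R (LinearMap.ker q)) (n + 1)) :=
  subsingleton_ext_left_succ X (LinearMap.shortExact_shortComplexKer hq) hC hB

lemma subsingleton_ext_hom_of_projective (X : ModuleCat.{0} R) (F N : Type) [AddCommGroup F]
    [Module R F] [Module.Projective R F] [AddCommGroup N] [Module R N] {n : ℕ}
    (h : Subsingleton (Abelian.Ext X (ModuleCat.of R N) (n + 1))) :
    Subsingleton (Abelian.Ext X (ModuleCat.of R (F →ₗ[R] N)) (n + 1)) := by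
  refine subsingleton_of_forall_eq 0 fun α ↦ ?_
  let P := projectiveResolution X
  obtain ⟨f, hf, rfl⟩ := P.extMk_surjective α (n + 2) rfl
  rw [P.extMk_eq_zero_iff _ _ _ _ n rfl]
  let δ : (P.complex.X n →ₗ[R] N) →ₗ[R] (P.complex.X (n + 1) →ₗ[R] N) :=
    (P.complex.d (n + 1) n).hom.lcomp R N
  have hmem : ∀ x, f.hom.flip x ∈ LinearMap.range δ := fun x ↦ by
    have hx : P.complex.d (n + 2) (n + 1) ≫ ModuleCat.ofHom (f.hom.flip x) = 0 := by
      ext p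
      exact congr($(ModuleCat.hom_ext_iff.mp hf) p x)
    obtain ⟨g, hg⟩ := (P.extMk_eq_zero_iff (ModuleCat.ofHom (f.hom.flip x)) _ rfl hx n rfl).mp
      (Subsingleton.elim _ _)
    exact ⟨g.hom, ModuleCat.hom_ext_iff.mp hg⟩
  obtain ⟨g, hg⟩ := Module.projective_lifting_property δ.rangeRestrict
    (f.hom.flip.codRestrict _ hmem) δ.surjective_rangeRestrict
  refine ⟨ModuleCat.ofHom g.flip, ?_⟩
  ext p x
  exact congr(($hg x).1 p)

lemma subsingleton_linearMap_hom {X K N : Type} [AddCommGroup X] [Module R X] [AddCommGroup K]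
    [Module R K] [AddCommGroup N] [Module R N] (h : Subsingleton (X →ₗ[R] N)) :
    Subsingleton (X →ₗ[R] K →ₗ[R] N) :=
  ⟨fun a b ↦ by
    ext x y
    exact congr($(Subsingleton.elim (a.flip y) (b.flip y)) x)⟩

lemma subsingleton_linearMap_of_injective {X A B : Type} [AddCommGroup X] [Module R X]
    [AddCommGroup A] [Module R A] [AddCommGroup B] [Module R B] (f : A →ₗ[R] B)
    (hf : Function.Injective f) (h : Subsingleton (X →ₗ[R] B)) : Subsingleton (X →ₗ[R] A) :=
  ⟨fun a b ↦ by
    ext x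
    exact hf congr($(Subsingleton.elim (f ∘ₗ a) (f ∘ₗ b)) x)⟩

end ExtVanishing

section LinkedModule

variable {R : Type} [CommRing R] {M F : Type} [AddCommGroup M] [Module R M] [AddCommGroup F]
  [Module R F] [Module.Projective R F] (N : Type) [AddCommGroup N] [Module R N]
  (g : F →ₗ[R] M) (hg : Function.Surjective g)

/-- The connecting map `Ext^n(ker g, N) → Ext^{n+1}(M, N)` of `0 → ker g → F → M → 0`. -/
noncomputable def connectingExt (n : ℕ) :
    Abelian.Ext (ModuleCat.of R (LinearMap.ker g)) (ModuleCat.of R N) n →ₗ[R]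
      Abelian.Ext (ModuleCat.of R M) (ModuleCat.of R N) (n + 1) :=
  (LinearMap.shortExact_shortComplexKer hg).extClass.precompOfLinear R _ (add_comm 1 n)

lemma connectingExt_surjective (n : ℕ) : Function.Surjective (connectingExt N g hg n) :=
  haveI : Projective g.shortComplexKer.X₂ :=
    inferInstanceAs (Projective (ModuleCat.of R F))
  precomp_extClass_surjective_of_projective_X₂ (ModuleCat.of R N)
    (LinearMap.shortExact_shortComplexKer hg) n

/-- Dimension shifting: `Ext^{n+1}(ker g, N) ≃ Ext^{n+2}(M, N)` when `g : F → M` is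
surjective with `F` projective. -/
noncomputable def dimensionShiftExt (n : ℕ) :
    Abelian.Ext (ModuleCat.of R (LinearMap.ker g)) (ModuleCat.of R N) (n + 1) ≃ₗ[R]
      Abelian.Ext (ModuleCat.of R M) (ModuleCat.of R N) (n + 2) :=
  LinearEquiv.ofBijective (connectingExt N g hg (n + 1)) ⟨by
    rw [injective_iff_map_eq_zero]
    intro x hx
    obtain ⟨y, rfl⟩ := Abelian.Ext.contravariant_sequence_exact₁
      (LinearMap.shortExact_shortComplexKer hg) _ x (add_comm 1 _) hx
    have : Projective g.shortComplexKer.X₂ :=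
      inferInstanceAs (Projective (ModuleCat.of R F))
    rw [y.eq_zero_of_projective, Abelian.Ext.comp_zero],
  connectingExt_surjective N g hg (n + 1)⟩

/-- The surjection `Hom(ker g, N) → Ext^1(M, N)`. -/
noncomputable def homToExtOne :
    (LinearMap.ker g →ₗ[R] N) →ₗ[R]
      Abelian.Ext (ModuleCat.of R M) (ModuleCat.of R N) 1 :=
  connectingExt N g hg 0 ∘ₗ Abelian.Ext.linearEquiv₀.symm.toLinearMap ∘ₗ
    (ModuleCat.homLinearEquiv (S := R) (M := ModuleCat.of R (LinearMap.ker g))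
      (N := ModuleCat.of R N)).symm.toLinearMap

lemma homToExtOne_surjective : Function.Surjective (homToExtOne N g hg) :=
  (connectingExt_surjective N g hg 0).comp
    ((Abelian.Ext.linearEquiv₀ (R := R)).symm.surjective.comp
      (ModuleCat.homLinearEquiv (S := R)).symm.surjective)

omit [Module.Projective R F] in
lemma ker_homToExtOne :
    LinearMap.ker (homToExtOne N g hg) =
      LinearMap.range ((LinearMap.ker g).subtype.lcomp R N) := by
  ext φ
  have hS := LinearMap.shortExact_shortComplexKer hg
  constructor
  · intro h
    obtain ⟨y, hy⟩ := Abelian.Ext.contravariant_sequence_exact₁ hS _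
      (Abelian.Ext.mk₀ (ModuleCat.ofHom φ)) rfl h
    obtain ⟨y, rfl⟩ := (Abelian.Ext.mk₀_bijective _ _).2 y
    rw [Abelian.Ext.mk₀_comp_mk₀] at hy
    exact ⟨y.hom, ModuleCat.hom_ext_iff.mp ((Abelian.Ext.mk₀_bijective _ _).1 hy)⟩
  · rintro ⟨ψ, rfl⟩
    change hS.extClass.comp (Abelian.Ext.mk₀ (g.shortComplexKer.f ≫ ModuleCat.ofHom ψ))
      (add_comm 1 0) = 0
    rw [← Abelian.Ext.mk₀_comp_mk₀]
    exact hS.extClass_comp_assoc _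

end LinkedModule

section Depth

variable {R : Type} [CommRing R]

/-- If `Ext^i(X, N) = 0` for `i ≤ n` and `Ext^i(X, Ext^j(M, N)) = 0` whenever `1 ≤ j` and
`i + j ≤ n`, then `Ext^n(X, B) = 0`, where `B` is the image of `Hom(F, N) → Hom(ker g, N)` for
a surjection `g : F → M` from a projective module. -/
theorem subsingleton_ext_range_restrict (X N : Type) [AddCommGroup X] [Module R X]
    [AddCommGroup N] [Module R N] (n : ℕ)
    (hN : ∀ i ≤ n, Subsingleton (Abelian.Ext (ModuleCat.of R X) (ModuleCat.of R N) i))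
    (M F : Type) [AddCommGroup M] [Module R M] [AddCommGroup F]
    [Module R F] [Module.Projective R F] (g : F →ₗ[R] M) (hg : Function.Surjective g)
    (hM : ∀ i j : ℕ, i + (j + 1) ≤ n → Subsingleton (Abelian.Ext (ModuleCat.of R X)
      (ModuleCat.of R (Abelian.Ext (ModuleCat.of R M) (ModuleCat.of R N) (j + 1))) i)) :
    Subsingleton (Abelian.Ext (ModuleCat.of R X)
      (ModuleCat.of R (LinearMap.range ((LinearMap.ker g).subtype.lcomp R N))) n) := by
  induction n generalizing M F with
  | zero =>
    exact subsingleton_ext_zero_iff.mpr (subsingleton_linearMap_of_injective _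
      (Submodule.subtype_injective _)
      (subsingleton_linearMap_hom (subsingleton_ext_zero_iff.mp (hN 0 le_rfl))))
  | succ n ih =>
    rw [← ker_homToExtOne N g hg]
    refine subsingleton_ext_ker_succ _ _ (homToExtOne_surjective N g hg) (hM n 0 le_rfl) ?_
    let g' : (LinearMap.ker g →₀ R) →ₗ[R] LinearMap.ker g := Finsupp.linearCombination R id
    have hg' : Function.Surjective g' := Finsupp.linearCombination_id_surjective R _
    have hB := ih (fun i hi ↦ hN i (hi.trans n.le_succ)) (LinearMap.ker g) _ g' hg'
      fun i j hij ↦ subsingleton_ext_of_linearEquiv (dimensionShiftExt N g hg j).symm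
        (hM i (j + 1) (by lia))
    let r := (LinearMap.ker g').subtype.lcomp R N
    have hF := subsingleton_ext_hom_of_projective (ModuleCat.of R X) (LinearMap.ker g →₀ R) N
      (hN (n + 1) le_rfl)
    have hinj : Function.Injective (g'.lcomp R N) := fun a b h ↦ by
      ext x
      obtain ⟨y, rfl⟩ := hg' x
      exact congr($h y)
    have hker : LinearMap.ker r.rangeRestrict = LinearMap.range (g'.lcomp R N) := by
      rw [LinearMap.ker_rangeRestrict]
      ext φ
      constructor
      · intro h
        refine ⟨(LinearMap.ker g').liftQ φ (fun x hx ↦ congr($h ⟨x, hx⟩)) ∘ₗ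
          (g'.quotKerEquivOfSurjective hg').symm.toLinearMap, ?_⟩
        ext x
        simp
      · rintro ⟨ψ, rfl⟩
        ext x
        simp [r]
    refine subsingleton_ext_of_linearEquiv (Y := ModuleCat.of R (LinearMap.ker r.rangeRestrict))
      (LinearEquiv.ofEq _ _ hker ≪≫ₗ
      (LinearEquiv.ofInjective _ hinj).symm) ?_
    exact subsingleton_ext_ker_succ _ _ r.surjective_rangeRestrict hB hF

variable [IsLocalRing R]

lemma subsingleton_ext_of_lt_rdepth {N : Type} [AddCommGroup N] [Module R N] {i : ℕ}
    (h : (i : ℕ∞) < rdepth R N) :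
    Subsingleton (Abelian.Ext (ModuleCat.of R (ResidueField R)) (ModuleCat.of R N) i) := by
  rw [← (extObjLinearEquiv _ _ i).toEquiv.subsingleton_congr]
  by_contra hn
  exact h.not_ge (sInf_le ⟨i, not_subsingleton_iff_nontrivial.mp hn, rfl⟩)

lemma le_rdepth_of_forall_lt {N : Type} [AddCommGroup N] [Module R N] {c : ℕ∞}
    (h : ∀ n : ℕ, (n : ℕ∞) < c →
      Subsingleton (Abelian.Ext (ModuleCat.of R (ResidueField R)) (ModuleCat.of R N) n)) :
    c ≤ rdepth R N := by
  refine le_sInf ?_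
  rintro _ ⟨n, hn, rfl⟩
  by_contra hlt
  exact not_subsingleton_iff_nontrivial.mpr hn
    ((extObjLinearEquiv _ _ n).toEquiv.subsingleton_congr.mpr (h n (not_le.mp hlt)))

lemma rdepth_self_le_ringKrullDim [IsNoetherianRing R] {d : ℕ} (hdim : ringKrullDim R = d) :
    rdepth R R ≤ d := by
  by_contra! hlt
  obtain ⟨rs, hlen, -, hreg⟩ := ModuleCat.exists_isRegular_of_exists_subsingleton_ext
    (maximalIdeal R) (d + 1) (ModuleCat.of R R)
    (by simpa [lt_top_iff_ne_top] using (maximalIdeal.isMaximal R).ne_top)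
    (ModuleCat.of R (ResidueField R))
    (by
      rw [Module.support_eq_zeroLocus]
      exact congrArg (fun I : Ideal R ↦ PrimeSpectrum.zeroLocus (I : Set R))
        (Ideal.annihilator_quotient (I := maximalIdeal R)))
    fun i hi ↦ subsingleton_ext_of_lt_rdepth
      (lt_of_le_of_lt (by exact_mod_cast Nat.lt_succ_iff.mp hi) hlt)
  have hd := ringKrullDim_add_length_eq_ringKrullDim_of_isRegular rs hreg
  have : Nontrivial (R ⧸ Ideal.ofList rs) :=
    Ideal.Quotient.nontrivial_iff.mpr fun h ↦ hreg.top_ne_smul (by simp [h])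
  have h0 : 0 ≤ ringKrullDim (R ⧸ Ideal.ofList rs) := ringKrullDim_nonneg_of_nontrivial
  rw [hdim, hlen] at hd
  have h1 : ((d + 1 : ℕ) : WithBot ℕ∞) ≤ (d : ℕ) := hd ▸ le_add_of_nonneg_left h0
  exact absurd (Nat.cast_le.mp h1) (by lia)

end Depth

/-- Over a Noetherian local ring `R` of dimension `d`, if `M` is a finitely
generated SDE module with finite free presentation `F₁ →f F₀ → M → 0` and
`λM = image(f* : Hom(F₀,R) → Hom(F₁,R))`, then `depth λM ≥ min (depth M) (depth R)`. -/
theorem statement1 (R : Type) [CommRing R] [IsNoetherianRing R] [IsLocalRing R]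
    (d : ℕ) (hdim : ringKrullDim R = (d : ℕ))
    (M F₀ F₁ : Type) [AddCommGroup M] [Module R M] [Module.Finite R M]
    [AddCommGroup F₀] [Module R F₀] [Module.Free R F₀] [Module.Finite R F₀]
    [AddCommGroup F₁] [Module R F₁] [Module.Free R F₁] [Module.Finite R F₁]
    (f : F₁ →ₗ[R] F₀) (g : F₀ →ₗ[R] M) (hg : Function.Surjective g)
    (hfg : LinearMap.range f = LinearMap.ker g)
    (hSDE : isSDE R M d) :
    min (rdepth R M) (rdepth R R) ≤ rdepth R ↥(LinearMap.range f.dualMap) := by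
  refine le_rdepth_of_forall_lt fun n hn ↦ ?_
  have hnR : (n : ℕ∞) < rdepth R R := hn.trans_le (min_le_right _ _)
  have hnd : n < d := by exact_mod_cast hnR.trans_le (rdepth_self_le_ringKrullDim hdim)
  have key := subsingleton_ext_range_restrict (ResidueField R) R n
    (fun i hi ↦ subsingleton_ext_of_lt_rdepth (lt_of_le_of_lt (by exact_mod_cast hi) hnR))
    M F₀ g hg fun i j hij ↦ subsingleton_ext_of_linearEquiv
      (extObjLinearEquiv (ModuleCat.of R M) (ModuleCat.of R R) (j + 1)) <| by
        obtain h | h := hSDE (j + 1) (by lia) (by lia)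
        · exact @subsingleton_ext_of_subsingleton _ _ _ _ _ h
        · exact subsingleton_ext_of_lt_rdepth
            (lt_of_lt_of_le (by exact_mod_cast (by lia : i < d - (j + 1))) h)
  let f' : F₁ →ₗ[R] LinearMap.ker g := f.codRestrict _ fun x ↦ hfg ▸ LinearMap.mem_range_self f x
  have hf' : Function.Surjective f' := fun ⟨y, hy⟩ ↦ by
    obtain ⟨x, rfl⟩ := hfg ▸ hy
    exact ⟨x, rfl⟩
  have hmap : (LinearMap.range ((LinearMap.ker g).subtype.lcomp R R)).map f'.dualMap =
      LinearMap.range f.dualMap := (LinearMap.range_comp _ _).symm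
  exact subsingleton_ext_of_linearEquiv (Submodule.equivMapOfInjective _
    (LinearMap.dualMap_injective_of_surjective hf') _ ≪≫ₗ LinearEquiv.ofEq _ _ hmap) key
end

section
/- Let (R, 𝔪) be a Cohen-Macaulay Noetherian local ring of Krull dimension d and let M be a finitely generated R-module which is maximal Cohen-Macaulay (depth_R M = d) and SDE. Let F₁ →f F₀ → M → 0 be a finite free presentation and λM := image(f* : Hom_R(F₀,R) → Hom_R(F₁,R)). Then λM is either zero or a maximal Cohen-Macaulay R-module, i.e. depth_R(λM) ≥ d. -/
open CategoryTheory Opposite IsLocalRing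

section ProjectiveResolutionOfEpi

open CategoryTheory.Limits

variable {C : Type*} [Category* C] [Abelian C]

/-- A projective resolution from an exact sequence of projective objects. -/
noncomputable def projectiveResolutionOfExact {Z : C} (X : ℕ → C) [∀ n, Projective (X n)]
    (d : ∀ n, X (n + 1) ⟶ X n) (p : X 0 ⟶ Z) (hepi : Epi p) (w : ∀ n, d (n + 1) ≫ d n = 0)
    (w₀ : d 0 ≫ p = 0) (hd : ∀ n, (ShortComplex.mk _ _ (w n)).Exact)
    (hp : (ShortComplex.mk _ _ w₀).Exact) : ProjectiveResolution Z where
  complex := ChainComplex.of X d w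
  projective n := inferInstanceAs (Projective (X n))
  π := (ChainComplex.toSingle₀Equiv _ _).symm ⟨p, by
    exact (congrArg (· ≫ p) (ChainComplex.of_d X d 0)).trans w₀⟩
  quasiIso := ⟨fun n => by
    cases n with
    | zero =>
      rw [ChainComplex.quasiIsoAt₀_iff, ShortComplex.quasiIso_iff_of_zeros' _ rfl rfl rfl]
      refine (ShortComplex.exact_and_epi_g_iff_of_iso ?_).2
        ⟨hp, hepi⟩
      refine ShortComplex.isoMk (Iso.refl (X 1)) (Iso.refl (X 0)) (Iso.refl Z) ?_ ?_
      · exact (Category.id_comp _).trans ((ChainComplex.of_d X d 0).symm.trans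
          (Category.comp_id _).symm)
      · let q : X 0 ⟶ Z := ((ChainComplex.toSingle₀Equiv (ChainComplex.of X d w) Z).symm
          ⟨p, (congrArg (· ≫ p) (ChainComplex.of_d X d 0)).trans w₀⟩).f 0
        have hq : q = p :=
          ChainComplex.toSingle₀Equiv_symm_apply_f_zero (C := ChainComplex.of X d w) (X := Z) p
            ((congrArg (· ≫ p) (ChainComplex.of_d X d 0)).trans w₀)
        exact (Category.id_comp p).trans (hq.symm.trans (Category.comp_id q).symm)
    | succ n =>
      rw [quasiIsoAt_iff_exactAt' _ _ (ChainComplex.exactAt_succ_single_obj _ _),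
        HomologicalComplex.exactAt_iff' _ (n + 1 + 1) (n + 1) n (by simp) (by simp)]
      have e : (ChainComplex.of X d w).sc' (n + 1 + 1) (n + 1) n ≅ ShortComplex.mk _ _ (w n) :=
        ShortComplex.isoMk (Iso.refl (X (n + 1 + 1))) (Iso.refl (X (n + 1))) (Iso.refl (X n))
          ((Category.id_comp _).trans ((ChainComplex.of_d X d (n + 1)).symm.trans
            (Category.comp_id _).symm))
          ((Category.id_comp _).trans ((ChainComplex.of_d X d n).symm.trans
            (Category.comp_id _).symm))
      exact (ShortComplex.exact_iff_of_iso e).2 (hd n)⟩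

variable [EnoughProjectives C] {P Z : C}

/-- The arrows of a projective resolution starting with a given morphism. -/
noncomputable def syzygyArrow (p : P ⟶ Z) : ℕ → Arrow C
  | 0 => Arrow.mk p
  | n + 1 => Arrow.mk (Projective.d (syzygyArrow p n).hom)

/-- A projective resolution whose augmentation is a given epimorphism from a projective object. -/
noncomputable def projectiveResolutionOfEpi [hP : Projective P] (p : P ⟶ Z) [Epi p] :
    ProjectiveResolution Z :=
  have (n : ℕ) : Projective (syzygyArrow p n).left := by
    cases n
    · exact hP
    · exact Projective.projective_over _
  projectiveResolutionOfExact (fun n => (syzygyArrow p n).left)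
    (fun n => Projective.d (syzygyArrow p n).hom) p ‹Epi p› _ _
    (fun n => exact_d_f (syzygyArrow p (n + 1)).hom) (exact_d_f p)

end ProjectiveResolutionOfEpi

section ExtModule

variable {R : Type} [CommRing R] {X N : Type} [AddCommGroup X] [Module R X]
  [AddCommGroup N] [Module R N]

lemma subsingleton_extMod_iff (P : ProjectiveResolution (ModuleCat.of R X)) (i : ℕ) :
    Subsingleton (extMod R X N i) ↔ ∀ φ : P.complex.X i →ₗ[R] N,
      φ ∘ₗ (P.complex.d (i + 1) i).hom = 0 →
        ∃ ψ : P.complex.X (i - 1) →ₗ[R] N, ψ ∘ₗ (P.complex.d i (i - 1)).hom = φ := by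
  have e := P.isoExt (R := R) i (ModuleCat.of R N)
  have h1 : Subsingleton (extMod R X N i) ↔
      (P.complex.linearYonedaObj R (ModuleCat.of R N)).ExactAt i := by
    rw [HomologicalComplex.exactAt_iff_isZero_homology, ← e.isZero_iff,
      ModuleCat.isZero_iff_subsingleton]
    rfl
  rw [h1, HomologicalComplex.exactAt_iff' _ (i - 1) i (i + 1) (by cases i <;> simp) (by simp),
    ShortComplex.moduleCat_exact_iff]
  constructor
  · intro h φ hφ
    obtain ⟨ψ, hψ⟩ := h (ModuleCat.ofHom φ) (by
      refine ModuleCat.hom_ext ?_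
      exact hφ)
    exact ⟨ψ.hom, congrArg ModuleCat.Hom.hom hψ⟩
  · intro h φ hφ
    obtain ⟨ψ, hψ⟩ := h φ.hom (congrArg ModuleCat.Hom.hom hφ)
    exact ⟨ModuleCat.ofHom ψ, ModuleCat.hom_ext hψ⟩

/-- A projective resolution computes `extMod` as cocycles modulo coboundaries. -/
noncomputable def extModSuccEquiv (P : ProjectiveResolution (ModuleCat.of R X)) (i : ℕ) :
    extMod R X N (i + 1) ≃ₗ[R]
      (LinearMap.ker (LinearMap.lcomp R N (P.complex.d (i + 2) (i + 1)).hom)) ⧸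
        (LinearMap.range (LinearMap.lcomp R N (P.complex.d (i + 1) i).hom)).submoduleOf _ := by
  let K := P.complex.linearYonedaObj R (ModuleCat.of R N)
  let S := K.sc' i (i + 1) (i + 2)
  let e : extMod R X N (i + 1) ≅ S.moduleCatLeftHomologyData.H :=
    P.isoExt (R := R) (i + 1) (ModuleCat.of R N) ≪≫
      ShortComplex.homologyMapIso (K.isoSc' i (i + 1) (i + 2) (by simp) (by simp)) ≪≫
      S.moduleCatHomologyIso
  have e' : extMod R X N (i + 1) ≃ₗ[R]
      LinearMap.ker S.g.hom ⧸ LinearMap.range S.moduleCatToCycles := e.toLinearEquiv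
  let E (n : ℕ) : (P.complex.X n ⟶ ModuleCat.of R N) ≃ₗ[R] (P.complex.X n →ₗ[R] N) :=
    ModuleCat.homLinearEquiv
  let F : LinearMap.ker S.g.hom ≃ₗ[R]
      LinearMap.ker (LinearMap.lcomp R N (P.complex.d (i + 2) (i + 1)).hom) :=
    (E (i + 1)).ofSubmodules _ _ (by
      ext φ
      constructor
      · rintro ⟨χ, hχ, rfl⟩
        exact congrArg ModuleCat.Hom.hom hχ
      · exact fun h => ⟨ModuleCat.ofHom φ, ModuleCat.hom_ext h, rfl⟩)
  refine e'.trans (Submodule.Quotient.equiv _ _ F ?_)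
  ext φ
  rw [Submodule.mem_map_equiv]
  change _ ↔ φ.1 ∈ LinearMap.range _
  constructor
  · rintro ⟨ψ, hψ⟩
    exact ⟨E i ψ, congrArg (fun z => E (i + 1) (Subtype.val z)) hψ⟩
  · rintro ⟨ψ, hψ⟩
    exact ⟨(E i).symm ψ, Subtype.ext (ModuleCat.hom_ext hψ)⟩

/-- Vanishing of `Ext` against a fixed module descends to the kernel of a surjection. -/
lemma subsingleton_extMod_of_shortExact {A B D : Type} [AddCommGroup A] [Module R A]
    [AddCommGroup B] [Module R B] [AddCommGroup D] [Module R D] (f : A →ₗ[R] B) (g : B →ₗ[R] D)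
    (hf : Function.Injective f) (hg : Function.Surjective g)
    (hfg : LinearMap.range f = LinearMap.ker g) (i : ℕ)
    (hB : Subsingleton (extMod R X B i))
    (hD : ∀ j, j + 1 = i → Subsingleton (extMod R X D j)) :
    Subsingleton (extMod R X A i) := by
  let P := projectiveResolution (ModuleCat.of R X)
  rw [subsingleton_extMod_iff P] at hB ⊢
  have gf : g ∘ₗ f = 0 := LinearMap.range_le_ker_iff.1 hfg.le
  have lift {j : ℕ} (φ : P.complex.X j →ₗ[R] B) (h : g ∘ₗ φ = 0) :
      ∃ χ : P.complex.X j →ₗ[R] A, f ∘ₗ χ = φ := by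
    let e := LinearEquiv.ofInjective f hf
    refine ⟨e.symm.toLinearMap ∘ₗ φ.codRestrict _ (fun x => ?_), ?_⟩
    · rw [hfg]
      exact LinearMap.congr_fun h x
    · ext x
      exact congrArg Subtype.val (e.apply_symm_apply _)
  intro φ hφ
  obtain ⟨ψ, hψ⟩ := hB (f ∘ₗ φ) (by rw [LinearMap.comp_assoc, hφ, LinearMap.comp_zero])
  cases i with
  | zero =>
    refine ⟨0, LinearMap.ext fun x => hf ?_⟩
    have h0 := LinearMap.congr_fun hψ x
    rw [P.complex.shape 0 (0 - 1) (by simp)] at h0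
    simpa using h0
  | succ j =>
    obtain ⟨ψ, hψ⟩ : ∃ ψ : P.complex.X j →ₗ[R] B,
      ψ ∘ₗ (P.complex.d (j + 1) j).hom = f ∘ₗ φ := ⟨ψ, hψ⟩
    have hD := (subsingleton_extMod_iff P j).1 (hD j rfl)
    obtain ⟨θ, hθ⟩ := hD (g ∘ₗ ψ) (by
      rw [LinearMap.comp_assoc]
      refine (congrArg (g ∘ₗ ·) hψ).trans ?_
      rw [← LinearMap.comp_assoc, gf, LinearMap.zero_comp])
    have : Module.Projective R (P.complex.X (j - 1)) :=
      (IsProjective.iff_projective _).2 (P.projective (j - 1))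
    obtain ⟨θ', rfl⟩ := Module.projective_lifting_property g θ hg
    obtain ⟨χ, hχ⟩ := lift (ψ - θ' ∘ₗ (P.complex.d j (j - 1)).hom) (by
      rw [LinearMap.comp_sub, ← LinearMap.comp_assoc, hθ, sub_self])
    refine ⟨χ, LinearMap.ext fun x => hf ?_⟩
    have h1 := LinearMap.congr_fun hχ (P.complex.d (j + 1) j x)
    have h2 := LinearMap.congr_fun hψ x
    have h3 : P.complex.d j (j - 1) (P.complex.d (j + 1) j x) = 0 :=
      LinearMap.congr_fun (congrArg ModuleCat.Hom.hom
        (P.complex.d_comp_d (j + 1) j (j - 1))) x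
    simp only [LinearMap.comp_apply, LinearMap.sub_apply] at h1 h2
    rw [h3, map_zero, sub_zero] at h1
    exact h1.trans h2

lemma subsingleton_extMod_congr {A B : Type} [AddCommGroup A] [Module R A]
    [AddCommGroup B] [Module R B] (e : A ≃ₗ[R] B) (i : ℕ)
    (h : Subsingleton (extMod R X B i)) : Subsingleton (extMod R X A i) :=
  ((((Ext R (ModuleCat R) i).obj (op (ModuleCat.of R X))).mapIso
    e.toModuleIso).toLinearEquiv).toEquiv.subsingleton_congr.2 h

/-- `Ext` into the dual of a projective module vanishes if `Ext` into the ring does. -/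
lemma subsingleton_extMod_dual {Q : Type} [AddCommGroup Q] [Module R Q] [Module.Projective R Q]
    (i : ℕ) (h : Subsingleton (extMod R X R i)) :
    Subsingleton (extMod R X (Q →ₗ[R] R) i) := by
  let P := projectiveResolution (ModuleCat.of R X)
  rw [subsingleton_extMod_iff P] at h ⊢
  intro φ hφ
  have hφq (q : Q) : ∃ ψ : P.complex.X (i - 1) →ₗ[R] R,
      ψ ∘ₗ (P.complex.d i (i - 1)).hom = LinearMap.applyₗ q ∘ₗ φ :=
    h _ (by rw [LinearMap.comp_assoc, hφ, LinearMap.comp_zero])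
  choose ψ hψ using hφq
  obtain ⟨s, hs⟩ := Module.Projective.out (R := R) (P := Q)
  let ψ' : (Q →₀ R) →ₗ[R] P.complex.X (i - 1) →ₗ[R] R := Finsupp.linearCombination R ψ
  let φ' : (Q →₀ R) →ₗ[R] P.complex.X i →ₗ[R] R := φ.flip ∘ₗ Finsupp.linearCombination R id
  have hφ' : LinearMap.lcomp R R (P.complex.d i (i - 1)).hom ∘ₗ ψ' = φ' := by
    ext q x
    simpa [φ', ψ'] using LinearMap.congr_fun (hψ q) x
  refine ⟨(ψ' ∘ₗ s).flip, ?_⟩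
  ext x q
  have h1 := LinearMap.congr_fun (LinearMap.congr_fun hφ' (s q)) x
  have h2 : φ' (s q) x = φ x q := congrArg (φ x) (hs q)
  exact h1.trans h2

end ExtModule

/-- Depth chase along a complex: if the terms of a complex have depth at least `d` and the
cohomology in degree `i + 1` has depth at least `d - (i + 1)`, then the image of the `i`-th
differential has depth at least `d - i`. -/
lemma subsingleton_extMod_range {R : Type} [CommRing R] {X : Type} [AddCommGroup X] [Module R X]
    (D : ℕ → Type) [∀ i, AddCommGroup (D i)] [∀ i, Module R (D i)]
    (δ : ∀ i, D i →ₗ[R] D (i + 1)) (hδ : ∀ i, δ (i + 1) ∘ₗ δ i = 0) (d : ℕ)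
    (hD : ∀ i j, j < d → Subsingleton (extMod R X (D i) j))
    (hH : ∀ i j, j + (i + 1) < d → Subsingleton (extMod R X
      (LinearMap.ker (δ (i + 1)) ⧸ (LinearMap.range (δ i)).submoduleOf _) j))
    (i j : ℕ) (hij : j + i < d) : Subsingleton (extMod R X (LinearMap.range (δ i)) j) := by
  induction j using Nat.strong_induction_on generalizing i with
  | _ j ih =>
    have hle : LinearMap.range (δ i) ≤ LinearMap.ker (δ (i + 1)) :=
      LinearMap.range_le_ker_iff.2 (hδ i)
    refine subsingleton_extMod_of_shortExact (Submodule.inclusion hle) (Submodule.mkQ _)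
      (Submodule.inclusion_injective hle) (Submodule.mkQ_surjective _) ?_ j ?_
      fun k hk => hH i k (by omega)
    · rw [Submodule.ker_mkQ, Submodule.range_inclusion]
      rfl
    · exact subsingleton_extMod_of_shortExact (LinearMap.ker (δ (i + 1))).subtype
        (δ (i + 1)).rangeRestrict (Submodule.subtype_injective _)
        (LinearMap.surjective_rangeRestrict _) (by simp) j (hD _ j (by omega))
        fun k hk => ih k (by omega) (i + 1) (by omega)

lemma subsingleton_extMod_of_subsingleton {R : Type} [CommRing R] {X N : Type} [AddCommGroup X]
    [Module R X] [AddCommGroup N] [Module R N] [Subsingleton N] (i : ℕ) :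
    Subsingleton (extMod R X N i) :=
  (subsingleton_extMod_iff (projectiveResolution _) i).2
    fun _ _ => ⟨0, Subsingleton.elim _ _⟩

lemma subsingleton_extMod_of_lt_rdepth {R : Type} [CommRing R] [IsLocalRing R] {N : Type}
    [AddCommGroup N] [Module R N] {i : ℕ} (h : (i : ℕ∞) < rdepth R N) :
    Subsingleton (extMod R (ResidueField R) N i) := by
  by_contra hn
  exact notMem_of_lt_csInf h (OrderBot.bddBelow _) ⟨i, not_subsingleton_iff_nontrivial.1 hn, rfl⟩

lemma le_rdepth {R : Type} [CommRing R] [IsLocalRing R] {N : Type}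
    [AddCommGroup N] [Module R N] {n : ℕ}
    (h : ∀ i < n, Subsingleton (extMod R (ResidueField R) N i)) : (n : ℕ∞) ≤ rdepth R N := by
  refine le_sInf ?_
  rintro _ ⟨i, hi, rfl⟩
  by_contra hn
  exact not_subsingleton_iff_nontrivial.2 hi (h i (by exact_mod_cast not_le.1 hn))

/-- The range of the transpose of `f` depends only on the range of `f`. -/
noncomputable def rangeLcompEquiv {R F₀ F₁ F₁' N : Type*} [CommRing R] [AddCommGroup F₀]
    [Module R F₀] [AddCommGroup F₁] [Module R F₁] [AddCommGroup F₁'] [Module R F₁']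
    [AddCommGroup N] [Module R N] (f : F₁ →ₗ[R] F₀) (f' : F₁' →ₗ[R] F₀)
    (h : LinearMap.range f = LinearMap.range f') :
    LinearMap.range (LinearMap.lcomp R N f) ≃ₗ[R] LinearMap.range (LinearMap.lcomp R N f') :=
  (LinearMap.quotKerEquivRange _).symm ≪≫ₗ Submodule.quotEquivOfEq _ _ (by
    ext φ
    simp only [LinearMap.mem_ker, LinearMap.lcomp_apply']
    rw [← LinearMap.range_le_ker_iff, h, LinearMap.range_le_ker_iff]) ≪≫ₗ
    LinearMap.quotKerEquivRange _

/-- Over a Cohen-Macaulay Noetherian local ring `R` of dimension `d`, if `M` is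
a finitely generated maximal Cohen-Macaulay SDE module with finite free presentation
`F₁ →f F₀ → M → 0` and `λM = image(f*)`, then `λM` is zero or maximal Cohen-Macaulay, i.e.
`depth λM ≥ d`. -/
theorem statement2 (R : Type) [CommRing R] [IsNoetherianRing R] [IsLocalRing R]
    (d : ℕ) (hR : isCMLocalRing R d)
    (M F₀ F₁ : Type) [AddCommGroup M] [Module R M] [Module.Finite R M]
    [AddCommGroup F₀] [Module R F₀] [Module.Free R F₀] [Module.Finite R F₀]
    [AddCommGroup F₁] [Module R F₁] [Module.Free R F₁] [Module.Finite R F₁]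
    (f : F₁ →ₗ[R] F₀) (g : F₀ →ₗ[R] M) (hg : Function.Surjective g)
    (hfg : LinearMap.range f = LinearMap.ker g)
    (hMCM : rdepth R M = (d : ℕ∞)) (hSDE : isSDE R M d) :
    (d : ℕ∞) ≤ rdepth R ↥(LinearMap.range f.dualMap) := by
  have : Epi (ModuleCat.ofHom g) := (ModuleCat.epi_iff_surjective _).2 hg
  have : Projective (ModuleCat.of R F₀) := (IsProjective.iff_projective _).1 inferInstance
  let P := projectiveResolutionOfEpi (ModuleCat.ofHom g)
  have hP (i : ℕ) : Module.Projective R (P.complex.X i) :=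
    (IsProjective.iff_projective _).2 (P.projective i)
  have hrange : LinearMap.range f = LinearMap.range (P.complex.d 1 0).hom := by
    have hπ : P.π.f 0 = ModuleCat.ofHom g := ChainComplex.toSingle₀Equiv_symm_apply_f_zero _ _
    rw [hfg, P.exact₀.moduleCat_range_eq_ker]
    exact congrArg (fun z => LinearMap.ker (ModuleCat.Hom.hom z)) hπ.symm
  refine le_rdepth fun j hj => subsingleton_extMod_congr
    (rangeLcompEquiv (N := R) f (P.complex.d 1 0).hom hrange) j ?_
  refine subsingleton_extMod_range (fun i => P.complex.X i →ₗ[R] R)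
    (fun i => LinearMap.lcomp R R (P.complex.d (i + 1) i).hom) (fun i => ?_) d
    (fun i k hk => subsingleton_extMod_dual k
      (subsingleton_extMod_of_lt_rdepth (by rw [hR.2]; exact_mod_cast hk)))
    (fun i k hk => subsingleton_extMod_congr (extModSuccEquiv P i).symm k ?_) 0 j hj
  · ext φ x
    have h : P.complex.d (i + 1) i (P.complex.d (i + 2) (i + 1) x) = 0 :=
      LinearMap.congr_fun (congrArg ModuleCat.Hom.hom
        (P.complex.d_comp_d (i + 2) (i + 1) i)) x
    exact (congrArg φ h).trans (map_zero φ)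
  · rcases hSDE (i + 1) (by omega) (by omega) with h | h
    · exact subsingleton_extMod_of_subsingleton k
    · exact subsingleton_extMod_of_lt_rdepth (lt_of_lt_of_le (by norm_cast; omega) h)
end

section
/- Let (R, 𝔪) be a Cohen-Macaulay Noetherian local ring of Krull dimension d ≥ 2 and let M be a finitely generated R-module with a resolution F_{d−1} →f_{d−1} ⋯ → F₁ →f₁ F₀ → M → 0 by finite free R-modules. For 1 ≤ i ≤ d−1 set 𝒯_i M := coker(f_i* : Hom_R(F_{i−1},R) → Hom_R(F_i,R)), and for 0 ≤ i ≤ d−2 set λΩ^i M := image(f_{i+1}* : Hom_R(F_i,R) → Hom_R(F_{i+1},R)). Then the following are equivalent: (i) M is SDE; (ii) depth_R(𝒯_i M) ≥ d−i for all i = 1, …, d−1; (iii) depth_R(λΩ^i M) ≥ d−i for all i = 0, …, d−2. (These conditions are independent of the chosen free resolution, since the modules 𝒯_i M and λΩ^i M change only by finite free direct summands and depth R = d.) -/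
open CategoryTheory Opposite IsLocalRing

noncomputable section

namespace CategoryTheory.ProjectiveResolution

variable {R : Type} [CommRing R]

/-- The augmentation of a projective resolution. -/
def augmentation {X : ModuleCat.{0} R} (Q : ProjectiveResolution X) : Q.complex.X 0 ⟶ X :=
  Q.π.f 0

lemma d_comp_augmentation {X : ModuleCat.{0} R} (Q : ProjectiveResolution X) :
    Q.complex.d 1 0 ≫ Q.augmentation = 0 :=
  Q.complex_d_comp_π_f_zero

lemma exact_augmentation {X : ModuleCat.{0} R} (Q : ProjectiveResolution X) :
    (ShortComplex.mk _ _ Q.d_comp_augmentation).Exact :=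
  Q.exact₀

instance {X : ModuleCat.{0} R} (Q : ProjectiveResolution X) : Epi Q.augmentation :=
  inferInstanceAs (Epi (Q.π.f 0))

lemma augmentation_comp_comp {K P M : ModuleCat.{0} R} (Q : ProjectiveResolution K)
    {ι : K ⟶ P} {π : P ⟶ M} (w : ι ≫ π = 0) : (Q.augmentation ≫ ι) ≫ π = 0 := by
  rw [Category.assoc, w, Limits.comp_zero]

/-- Splice a projective resolution of the kernel of a surjection from a projective object. -/
def splice {K P M : ModuleCat.{0} R} [hP : Projective P] (Q : ProjectiveResolution K)
    (ι : K ⟶ P) (π : P ⟶ M) [Mono ι] [Epi π] (w : ι ≫ π = 0)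
    (h : (ShortComplex.mk ι π w).Exact) : ProjectiveResolution M where
  complex := ChainComplex.augment Q.complex (Q.augmentation ≫ ι)
    (by rw [← Category.assoc, d_comp_augmentation, Limits.zero_comp])
  projective n := match n with
    | 0 => hP
    | n + 1 => Q.projective n
  π := (ChainComplex.toSingle₀Equiv _ _).symm ⟨π, augmentation_comp_comp Q w⟩
  quasiIso := ⟨fun n => by
    cases n with
    | zero =>
      rw [ChainComplex.quasiIsoAt₀_iff, ShortComplex.quasiIso_iff_of_zeros']
      · have h' : (ShortComplex.mk (Q.augmentation ≫ ι) π (augmentation_comp_comp Q w)).Exact := by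
          rw [ShortComplex.moduleCat_exact_iff] at h ⊢
          intro x hx
          obtain ⟨y, rfl⟩ := h x hx
          obtain ⟨z, rfl⟩ := (ModuleCat.epi_iff_surjective Q.augmentation).1 inferInstance y
          exact ⟨z, rfl⟩
        refine (ShortComplex.exact_and_epi_g_iff_of_iso ?_).2 ⟨h', ‹Epi π›⟩
        exact ShortComplex.isoMk (Iso.refl _) (Iso.refl _) (Iso.refl _)
          ((Category.id_comp _).trans (Category.comp_id _).symm)
          ((Category.id_comp _).trans
            ((ChainComplex.toSingle₀Equiv_symm_apply_f_zero
              (C := ChainComplex.augment Q.complex (Q.augmentation ≫ ι) _) (X := M) π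
              (augmentation_comp_comp Q w)).symm.trans (Category.comp_id _).symm))
      all_goals rfl
    | succ n =>
      rw [quasiIsoAt_iff_exactAt']
      · rw [HomologicalComplex.exactAt_iff' _ (n + 1 + 1) (n + 1) n (by simp) (by simp)]
        match n with
        | 0 =>
          have h' := Q.exact_augmentation
          rw [ShortComplex.moduleCat_exact_iff] at h' ⊢
          intro x hx
          exact h' x ((ModuleCat.mono_iff_injective ι).1 inferInstance
            (hx.trans (map_zero ι.hom).symm))
        | n + 1 => exact Q.exact_succ n
      · apply ChainComplex.exactAt_succ_single_obj⟩

end CategoryTheory.ProjectiveResolution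

lemma subsingleton_extMod_succ_iff {R : Type} [CommRing R] {X : Type} [AddCommGroup X] [Module R X]
    (Q : ProjectiveResolution (ModuleCat.of R X)) (N : Type) [AddCommGroup N] [Module R N] (i : ℕ) :
    Subsingleton (extMod R X N (i + 1)) ↔ ∀ φ : Q.complex.X (i + 1) →ₗ[R] N,
      φ ∘ₗ (Q.complex.d (i + 2) (i + 1)).hom = 0 →
        ∃ ψ : Q.complex.X i →ₗ[R] N, φ = ψ ∘ₗ (Q.complex.d (i + 1) i).hom := by
  rw [extMod, ← ModuleCat.isZero_iff_subsingleton, (Q.isoExt (i + 1) (ModuleCat.of R N)).isZero_iff,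
    ← HomologicalComplex.exactAt_iff_isZero_homology,
    HomologicalComplex.exactAt_iff' _ i (i + 1) (i + 2) (by simp) (by simp),
    ShortComplex.moduleCat_exact_iff]
  constructor
  · intro h φ hφ
    obtain ⟨ψ, hψ⟩ := h (ModuleCat.ofHom φ) (ModuleCat.hom_ext hφ)
    exact ⟨ψ.hom, congrArg ModuleCat.Hom.hom hψ.symm⟩
  · intro h φ hφ
    obtain ⟨ψ, hψ⟩ := h φ.hom (congrArg ModuleCat.Hom.hom hφ)
    exact ⟨ModuleCat.ofHom ψ, (ModuleCat.hom_ext hψ).symm⟩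

lemma subsingleton_extMod_zero_iff {R : Type} [CommRing R] {X : Type} [AddCommGroup X] [Module R X]
    (Q : ProjectiveResolution (ModuleCat.of R X)) (N : Type) [AddCommGroup N] [Module R N] :
    Subsingleton (extMod R X N 0) ↔ ∀ φ : Q.complex.X 0 →ₗ[R] N,
      φ ∘ₗ (Q.complex.d 1 0).hom = 0 → φ = 0 := by
  rw [extMod, ← ModuleCat.isZero_iff_subsingleton, (Q.isoExt 0 (ModuleCat.of R N)).isZero_iff,
    ← HomologicalComplex.exactAt_iff_isZero_homology,
    HomologicalComplex.exactAt_iff' _ 0 0 1 (by simp) (by simp),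
    ShortComplex.moduleCat_exact_iff]
  have h0 : Q.complex.d 0 0 = 0 := Q.complex.shape 0 0 (by simp)
  constructor
  · intro h φ hφ
    obtain ⟨ψ, hψ⟩ := h (ModuleCat.ofHom φ) (ModuleCat.hom_ext hφ)
    have hψ' : φ = (show Q.complex.X 0 ⟶ ModuleCat.of R N from ψ).hom ∘ₗ (Q.complex.d 0 0).hom :=
      congrArg ModuleCat.Hom.hom hψ.symm
    rw [hψ', h0, ModuleCat.hom_zero, LinearMap.comp_zero]
  · intro h φ hφ
    exact ⟨0, by rw [map_zero]; exact (ModuleCat.hom_ext (h φ.hom (congrArg ModuleCat.Hom.hom hφ))).symm⟩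


section

variable {R : Type} [CommRing R] {K P M : Type} [AddCommGroup K] [Module R K] [AddCommGroup P]
  [Module R P] [Module.Projective R P] [AddCommGroup M] [Module R M]

/-- The splicing of a projective resolution of the kernel, for modules. -/
def spliceOfExact (Q : ProjectiveResolution (ModuleCat.of R K)) (ι : K →ₗ[R] P) (π : P →ₗ[R] M)
    (hι : Function.Injective ι) (hπ : Function.Surjective π) (h : Function.Exact ι π) :
    ProjectiveResolution (ModuleCat.of R M) :=
  haveI : Mono (ModuleCat.ofHom ι) := (ModuleCat.mono_iff_injective _).2 hι
  haveI : Epi (ModuleCat.ofHom π) := (ModuleCat.epi_iff_surjective _).2 hπ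
  haveI : Projective (ModuleCat.of R P) := inferInstance
  Q.splice (ModuleCat.ofHom ι) (ModuleCat.ofHom π) (ModuleCat.hom_ext h.linearMap_comp_eq_zero)
    ((ShortComplex.moduleCat_exact_iff _).2 fun x hx => (h x).1 hx)

variable (N : Type) [AddCommGroup N] [Module R N]

lemma nonempty_extMod_succ_equiv (ι : K →ₗ[R] P) (π : P →ₗ[R] M)
    (hι : Function.Injective ι) (hπ : Function.Surjective π) (h : Function.Exact ι π) (i : ℕ) :
    Nonempty (extMod R M N (i + 2) ≃ₗ[R] extMod R K N (i + 1)) := by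
  let Q := projectiveResolution (ModuleCat.of R K)
  let Q' := spliceOfExact Q ι π hι hπ h
  let e : (Q'.complex.linearYonedaObj R (ModuleCat.of R N)).sc' (i + 1) (i + 2) (i + 3) ≅
      (Q.complex.linearYonedaObj R (ModuleCat.of R N)).sc' i (i + 1) (i + 2) :=
    Iso.refl _
  exact ⟨(Q'.isoExt (i + 2) (ModuleCat.of R N) ≪≫
    HomologicalComplex.homologyIsoSc' _ (i + 1) (i + 2) (i + 3) (by simp) (by simp) ≪≫
    ShortComplex.homologyMapIso e ≪≫
    (HomologicalComplex.homologyIsoSc' _ i (i + 1) (i + 2) (by simp) (by simp)).symm ≪≫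
    (Q.isoExt (i + 1) (ModuleCat.of R N)).symm).toLinearEquiv⟩

lemma nonempty_extMod_one_equiv (ι : K →ₗ[R] P) (π : P →ₗ[R] M)
    (hι : Function.Injective ι) (hπ : Function.Surjective π) (h : Function.Exact ι π) :
    Nonempty (extMod R M N 1 ≃ₗ[R] ((K →ₗ[R] N) ⧸ LinearMap.range (LinearMap.lcomp R N ι))) := by
  let Q := projectiveResolution (ModuleCat.of R K)
  let Q' := spliceOfExact Q ι π hι hπ h
  let S := (Q'.complex.linearYonedaObj R (ModuleCat.of R N)).sc' 0 1 2
  have hQ := Q.exact_augmentation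
  rw [ShortComplex.moduleCat_exact_iff] at hQ
  have hs : Function.Surjective Q.augmentation.hom :=
    (ModuleCat.epi_iff_surjective Q.augmentation).1 inferInstance
  have hd (x) : Q.augmentation.hom ((Q.complex.d 1 0).hom x) = 0 :=
    LinearMap.congr_fun (congrArg ModuleCat.Hom.hom Q.d_comp_augmentation) x
  let a : (K →ₗ[R] N) →ₗ[R] LinearMap.ker S.g.hom :=
    { toFun := fun φ => ⟨Q.augmentation ≫ ModuleCat.ofHom φ, by
        refine LinearMap.mem_ker.2 (ModuleCat.hom_ext (LinearMap.ext fun x => ?_))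
        exact (congrArg φ (hd x)).trans (map_zero φ)⟩
      map_add' := fun φ ψ => Subtype.ext (ModuleCat.hom_ext (LinearMap.add_comp _ _ _))
      map_smul' := fun r φ => Subtype.ext (ModuleCat.hom_ext (LinearMap.smul_comp _ _ _)) }
  have ha : Function.Bijective a := by
    constructor
    · intro φ ψ hφ
      have h1 : φ ∘ₗ Q.augmentation.hom = ψ ∘ₗ Q.augmentation.hom :=
        congrArg ModuleCat.Hom.hom (Subtype.ext_iff.1 hφ)
      exact (LinearMap.cancel_right hs).1 h1
    · rintro ⟨φ, hφ⟩
      change Q.complex.X 0 ⟶ ModuleCat.of R N at φ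
      have hφ' : φ.hom ∘ₗ (Q.complex.d 1 0).hom = 0 := congrArg ModuleCat.Hom.hom hφ
      have hle : LinearMap.ker Q.augmentation.hom ≤ LinearMap.ker φ.hom := by
        intro x hx
        obtain ⟨y, rfl⟩ := hQ x hx
        exact LinearMap.congr_fun hφ' y
      refine ⟨(LinearMap.ker Q.augmentation.hom).liftQ φ.hom hle ∘ₗ
        (Q.augmentation.hom.quotKerEquivOfSurjective hs).symm.toLinearMap,
        Subtype.ext (ModuleCat.hom_ext (LinearMap.ext fun x => ?_))⟩
      have h1 : (Q.augmentation.hom.quotKerEquivOfSurjective hs).symm (Q.augmentation.hom x) =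
          Submodule.Quotient.mk x :=
        (Q.augmentation.hom.quotKerEquivOfSurjective hs).symm_apply_apply (Submodule.Quotient.mk x)
      exact congrArg ((LinearMap.ker Q.augmentation.hom).liftQ φ.hom hle) h1
  refine ⟨((Q'.isoExt 1 (ModuleCat.of R N) ≪≫
    HomologicalComplex.homologyIsoSc' _ 0 1 2 (by simp) (by simp) ≪≫
    ShortComplex.moduleCatHomologyIso S).toLinearEquiv).trans
      (Submodule.Quotient.equiv _ _ (LinearEquiv.ofBijective a ha) ?_).symm⟩
  apply le_antisymm
  · rintro _ ⟨_, ⟨ψ, rfl⟩, rfl⟩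
    exact ⟨ModuleCat.ofHom ψ, Subtype.ext (ModuleCat.hom_ext rfl)⟩
  · rintro _ ⟨ψ, rfl⟩
    exact ⟨_, ⟨ModuleCat.Hom.hom (show ModuleCat.of R P ⟶ ModuleCat.of R N from ψ), rfl⟩,
      Subtype.ext (ModuleCat.hom_ext rfl)⟩

end

end

/-- Every `N`-valued `i`-cocycle of the sequence `⋯ → P 2 → P 1 → P 0` is a coboundary, where
`Hom(P (i + 1), N)` is placed in degree `i`. -/
def CocyclesBound {R : Type} [CommRing R] {P : ℕ → Type} [∀ i, AddCommGroup (P i)]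
    [∀ i, Module R (P i)] (δ : ∀ i, P (i + 1) →ₗ[R] P i) (N : Type) [AddCommGroup N] [Module R N]
    (i : ℕ) : Prop :=
  ∀ φ : P (i + 1) →ₗ[R] N, φ ∘ₗ δ (i + 1) = 0 → ∃ ψ : P i →ₗ[R] N, φ = ψ ∘ₗ δ i

namespace CocyclesBound

variable {R : Type} [CommRing R] {P : ℕ → Type} [∀ i, AddCommGroup (P i)]
  [∀ i, Module R (P i)] {δ : ∀ i, P (i + 1) →ₗ[R] P i}
  {A B C : Type} [AddCommGroup A] [Module R A] [AddCommGroup B] [Module R B]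
  [AddCommGroup C] [Module R C] {f : A →ₗ[R] B} {g : B →ₗ[R] C}

lemma exists_comp_eq {X : Type} [AddCommGroup X] [Module R X]
    (hf : Function.Injective f) (h : Function.Exact f g) {φ : X →ₗ[R] B} (hφ : g ∘ₗ φ = 0) :
    ∃ ψ : X →ₗ[R] A, f ∘ₗ ψ = φ := by
  let e := LinearEquiv.ofInjective f hf
  have hφ' (x : X) : φ x ∈ LinearMap.range f := (h (φ x)).1 (LinearMap.congr_fun hφ x)
  refine ⟨e.symm.toLinearMap ∘ₗ φ.codRestrict _ hφ', LinearMap.ext fun x => ?_⟩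
  exact congrArg Subtype.val (e.apply_symm_apply (φ.codRestrict _ hφ' x))

lemma middle [∀ i, Module.Projective R (P i)] (hδ : ∀ i, δ i ∘ₗ δ (i + 1) = 0)
    (hf : Function.Injective f) (hg : Function.Surjective g)
    (h : Function.Exact f g) {i : ℕ} (hA : CocyclesBound δ A i) (hC : CocyclesBound δ C i) :
    CocyclesBound δ B i := by
  intro φ hφ
  obtain ⟨ψ, hψ⟩ := hC (g ∘ₗ φ) (by rw [LinearMap.comp_assoc, hφ, LinearMap.comp_zero])
  obtain ⟨ψ', rfl⟩ := Module.projective_lifting_property g ψ hg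
  obtain ⟨χ, hχ⟩ := exists_comp_eq hf h (φ := φ - ψ' ∘ₗ δ i) (by
    rw [LinearMap.comp_sub, hψ, LinearMap.comp_assoc, sub_self])
  obtain ⟨θ, rfl⟩ := hA χ (by
    rw [← LinearMap.cancel_left hf, ← LinearMap.comp_assoc, hχ, LinearMap.sub_comp, hφ,
      LinearMap.comp_assoc, hδ, LinearMap.comp_zero, LinearMap.comp_zero, sub_zero])
  refine ⟨f ∘ₗ θ + ψ', ?_⟩
  rw [LinearMap.add_comp, LinearMap.comp_assoc, hχ, sub_add_cancel]

lemma left_zero [Subsingleton (P 0)] (hf : Function.Injective f) (hB : CocyclesBound δ B 0) :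
    CocyclesBound δ A 0 := by
  intro φ hφ
  obtain ⟨ψ, hψ⟩ := hB (f ∘ₗ φ) (by rw [LinearMap.comp_assoc, hφ, LinearMap.comp_zero])
  refine ⟨0, ?_⟩
  rw [← LinearMap.cancel_left hf, hψ, Subsingleton.elim (δ 0) 0]
  simp

lemma left_succ [∀ i, Module.Projective R (P i)] (hδ : ∀ i, δ i ∘ₗ δ (i + 1) = 0)
    (hf : Function.Injective f) (hg : Function.Surjective g)
    (h : Function.Exact f g) {i : ℕ} (hB : CocyclesBound δ B (i + 1)) (hC : CocyclesBound δ C i) :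
    CocyclesBound δ A (i + 1) := by
  intro φ hφ
  obtain ⟨ψ, hψ⟩ := hB (f ∘ₗ φ) (by rw [LinearMap.comp_assoc, hφ, LinearMap.comp_zero])
  obtain ⟨θ, hθ⟩ := hC (g ∘ₗ ψ) (by
    rw [LinearMap.comp_assoc, ← hψ, ← LinearMap.comp_assoc, h.linearMap_comp_eq_zero,
      LinearMap.zero_comp])
  obtain ⟨θ', rfl⟩ := Module.projective_lifting_property g θ hg
  obtain ⟨χ, hχ⟩ := exists_comp_eq hf h (φ := ψ - θ' ∘ₗ δ i) (by
    rw [LinearMap.comp_sub, hθ, LinearMap.comp_assoc, sub_self])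
  refine ⟨χ, ?_⟩
  rw [← LinearMap.cancel_left hf, ← LinearMap.comp_assoc, hχ, hψ, LinearMap.sub_comp,
    LinearMap.comp_assoc, hδ, LinearMap.comp_zero, sub_zero]

lemma right [∀ i, Module.Projective R (P i)] (hδ : ∀ i, δ i ∘ₗ δ (i + 1) = 0)
    (hf : Function.Injective f) (hg : Function.Surjective g)
    (h : Function.Exact f g) {i : ℕ} (hB : CocyclesBound δ B i) (hA : CocyclesBound δ A (i + 1)) :
    CocyclesBound δ C i := by
  intro φ hφ
  obtain ⟨φ', rfl⟩ := Module.projective_lifting_property g φ hg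
  obtain ⟨χ, hχ⟩ := exists_comp_eq hf h (φ := φ' ∘ₗ δ (i + 1)) (by rw [← hφ, LinearMap.comp_assoc])
  obtain ⟨ψ, rfl⟩ := hA χ (by
    rw [← LinearMap.cancel_left hf, ← LinearMap.comp_assoc, hχ, LinearMap.comp_assoc, hδ,
      LinearMap.comp_zero, LinearMap.comp_zero])
  obtain ⟨θ, hθ⟩ := hB (φ' - f ∘ₗ ψ) (by
    rw [LinearMap.sub_comp, LinearMap.comp_assoc, hχ, sub_self])
  refine ⟨g ∘ₗ θ, ?_⟩
  rw [LinearMap.comp_assoc, ← hθ, LinearMap.comp_sub, ← LinearMap.comp_assoc,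
    h.linearMap_comp_eq_zero, LinearMap.zero_comp, sub_zero]

lemma of_equiv (e : A ≃ₗ[R] B) {i : ℕ} (hA : CocyclesBound δ A i) : CocyclesBound δ B i := by
  intro φ hφ
  obtain ⟨ψ, hψ⟩ := hA (e.symm.toLinearMap ∘ₗ φ) (by
    rw [LinearMap.comp_assoc, hφ, LinearMap.comp_zero])
  refine ⟨e.toLinearMap ∘ₗ ψ, LinearMap.ext fun x => ?_⟩
  have := LinearMap.congr_fun hψ x
  simpa [LinearEquiv.symm_apply_eq] using this

lemma pi (ι : Type) {i : ℕ} (hA : CocyclesBound δ A i) : CocyclesBound δ (ι → A) i := by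
  intro φ hφ
  choose ψ hψ using fun j => hA (LinearMap.proj j ∘ₗ φ) (by
    rw [LinearMap.comp_assoc, hφ, LinearMap.comp_zero])
  exact ⟨LinearMap.pi ψ, LinearMap.ext fun x => funext fun j => LinearMap.congr_fun (hψ j) x⟩

end CocyclesBound

lemma exists_subsingleton_extMod_iff (R : Type) [CommRing R] (X : Type) [AddCommGroup X]
    [Module R X] : ∃ (P : ℕ → ModuleCat.{0} R) (δ : ∀ i, P (i + 1) →ₗ[R] P i),
      (∀ i, Module.Projective R (P i)) ∧ Subsingleton (P 0) ∧ (∀ i, δ i ∘ₗ δ (i + 1) = 0) ∧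
      ∀ (N : Type) [AddCommGroup N] [Module R N] (i : ℕ),
        Subsingleton (extMod R X N i) ↔ CocyclesBound (P := fun i => P i) δ N i := by
  let Q := projectiveResolution (ModuleCat.of R X)
  refine ⟨fun | 0 => ModuleCat.of R PUnit | i + 1 => Q.complex.X i,
    fun | 0 => 0 | i + 1 => (Q.complex.d (i + 1) i).hom, ?_, ?_, ?_, ?_⟩
  · rintro (_ | i)
    · exact inferInstanceAs (Module.Projective R PUnit)
    · exact (IsProjective.iff_projective (Q.complex.X i)).2 (Q.projective i)
  · exact inferInstanceAs (Subsingleton PUnit)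
  · rintro (_ | i)
    · exact LinearMap.zero_comp _
    · exact congrArg ModuleCat.Hom.hom (Q.complex.d_comp_d (i + 2) (i + 1) i)
  · intro N _ _ i
    cases i with
    | zero =>
      rw [subsingleton_extMod_zero_iff Q]
      refine forall₂_congr fun φ _ => ⟨?_, ?_⟩
      · rintro rfl
        exact ⟨0, rfl⟩
      · rintro ⟨ψ, rfl⟩
        exact LinearMap.comp_zero ψ
    | succ i => exact subsingleton_extMod_succ_iff Q N i

section depth

variable {R : Type} [CommRing R] [IsLocalRing R]

lemma le_rdepth_iff (N : Type) [AddCommGroup N] [Module R N] (n : ℕ) :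
    (n : ℕ∞) ≤ rdepth R N ↔ ∀ i < n, Subsingleton (extMod R (ResidueField R) N i) := by
  rw [rdepth, le_sInf_iff]
  constructor
  · intro h i hi
    by_contra hn
    have := h i ⟨i, not_subsingleton_iff_nontrivial.1 hn, rfl⟩
    exact absurd (Nat.cast_le.1 this) (not_le.2 hi)
  · rintro h _ ⟨i, hi, rfl⟩
    refine Nat.cast_le.2 (not_lt.1 fun hlt => ?_)
    exact not_subsingleton_iff_nontrivial.2 hi (h i hlt)

variable {A B C : Type} [AddCommGroup A] [Module R A] [AddCommGroup B] [Module R B]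
  [AddCommGroup C] [Module R C] {f : A →ₗ[R] B} {g : B →ₗ[R] C} {n : ℕ}

lemma le_rdepth_middle (hf : Function.Injective f) (hg : Function.Surjective g)
    (h : Function.Exact f g) (hA : (n : ℕ∞) ≤ rdepth R A) (hC : (n : ℕ∞) ≤ rdepth R C) :
    (n : ℕ∞) ≤ rdepth R B := by
  obtain ⟨P, δ, _, _, hδ, hP⟩ := exists_subsingleton_extMod_iff R (ResidueField R)
  simp only [le_rdepth_iff, hP] at *
  exact fun i hi => (hA i hi).middle hδ hf hg h (hC i hi)

lemma le_rdepth_left (hf : Function.Injective f) (hg : Function.Surjective g)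
    (h : Function.Exact f g) (hB : ((n + 1 : ℕ) : ℕ∞) ≤ rdepth R B) (hC : (n : ℕ∞) ≤ rdepth R C) :
    ((n + 1 : ℕ) : ℕ∞) ≤ rdepth R A := by
  obtain ⟨P, δ, _, _, hδ, hP⟩ := exists_subsingleton_extMod_iff R (ResidueField R)
  simp only [le_rdepth_iff, hP] at *
  rintro (_ | i) hi
  · exact (hB 0 hi).left_zero hf
  · exact (hB (i + 1) hi).left_succ hδ hf hg h (hC i (by omega))

lemma le_rdepth_right (hf : Function.Injective f) (hg : Function.Surjective g)
    (h : Function.Exact f g) (hB : (n : ℕ∞) ≤ rdepth R B)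
    (hA : ((n + 1 : ℕ) : ℕ∞) ≤ rdepth R A) : (n : ℕ∞) ≤ rdepth R C := by
  obtain ⟨P, δ, _, _, hδ, hP⟩ := exists_subsingleton_extMod_iff R (ResidueField R)
  simp only [le_rdepth_iff, hP] at *
  exact fun i hi => (hB i hi).right hδ hf hg h (hA (i + 1) (by omega))

lemma one_le_rdepth_of_injective (hf : Function.Injective f) (hB : ((1 : ℕ) : ℕ∞) ≤ rdepth R B) :
    ((1 : ℕ) : ℕ∞) ≤ rdepth R A :=
  le_rdepth_left hf (LinearMap.range f).mkQ_surjective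
    (LinearMap.exact_iff.2 (LinearMap.range f).ker_mkQ) hB (by simp)

lemma le_rdepth_of_equiv (e : A ≃ₗ[R] B) (hA : (n : ℕ∞) ≤ rdepth R A) :
    (n : ℕ∞) ≤ rdepth R B := by
  obtain ⟨P, δ, _, _, hδ, hP⟩ := exists_subsingleton_extMod_iff R (ResidueField R)
  simp only [le_rdepth_iff, hP] at *
  exact fun i hi => (hA i hi).of_equiv e

lemma le_rdepth_pi (ι : Type) (hA : (n : ℕ∞) ≤ rdepth R A) : (n : ℕ∞) ≤ rdepth R (ι → A) := by
  obtain ⟨P, δ, _, _, hδ, hP⟩ := exists_subsingleton_extMod_iff R (ResidueField R)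
  simp only [le_rdepth_iff, hP] at *
  exact fun i hi => (hA i hi).pi ι

lemma one_le_rdepth_dual (hR : ((1 : ℕ) : ℕ∞) ≤ rdepth R R) (N : Type) [AddCommGroup N]
    [Module R N] : ((1 : ℕ) : ℕ∞) ≤ rdepth R (Module.Dual R N) :=
  one_le_rdepth_of_injective (f := LinearMap.ltoFun R N R R) DFunLike.coe_injective
    (le_rdepth_pi N hR)

lemma le_rdepth_dual_of_free (hR : (n : ℕ∞) ≤ rdepth R R) (G : Type) [AddCommGroup G]
    [Module R G] [Module.Free R G] : (n : ℕ∞) ≤ rdepth R (Module.Dual R G) :=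
  le_rdepth_of_equiv ((Module.Free.chooseBasis R G).constr R) (le_rdepth_pi _ hR)

lemma le_rdepth_of_subsingleton [Subsingleton A] : (n : ℕ∞) ≤ rdepth R A := by
  obtain ⟨P, δ, _, _, hδ, hP⟩ := exists_subsingleton_extMod_iff R (ResidueField R)
  rw [le_rdepth_iff]
  exact fun i _ => (hP A i).2 fun φ _ => ⟨0, Subsingleton.elim _ _⟩

end depth

section dual

variable {R : Type} [CommRing R] {F G H : Type} [AddCommGroup F] [Module R F] [AddCommGroup G]
  [Module R G] [AddCommGroup H] [Module R H]

lemma nonempty_quotient_range_dualMap_equiv {f : G →ₗ[R] F} {f' : H →ₗ[R] G}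
    (h : LinearMap.range f' = LinearMap.ker f) :
    Nonempty ((Module.Dual R G ⧸ LinearMap.range f.rangeRestrict.dualMap) ≃ₗ[R]
      LinearMap.range f'.dualMap) := by
  have h1 : LinearMap.range f.rangeRestrict.dualMap = LinearMap.ker f'.dualMap := by
    rw [LinearMap.range_dualMap_eq_dualAnnihilator_ker_of_surjective _ f.surjective_rangeRestrict,
      LinearMap.ker_dualMap_eq_dualAnnihilator_range, h, LinearMap.ker_rangeRestrict]
  exact ⟨(Submodule.quotEquivOfEq _ _ h1).trans f'.dualMap.quotKerEquivRange⟩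

/-- The modules `Ext`, `𝒯` and `λΩ` of consecutive degrees form a short exact sequence. -/
lemma exists_exact_dual (f : G →ₗ[R] F) :
    ∃ (a : (Module.Dual R (LinearMap.range f) ⧸
          LinearMap.range (LinearMap.lcomp R R (LinearMap.range f).subtype)) →ₗ[R]
        (Module.Dual R G ⧸ LinearMap.range f.dualMap))
      (b : (Module.Dual R G ⧸ LinearMap.range f.dualMap) →ₗ[R]
        (Module.Dual R G ⧸ LinearMap.range f.rangeRestrict.dualMap)),
      Function.Injective a ∧ Function.Surjective b ∧ Function.Exact a b := by
  have hcomp (ψ : Module.Dual R F) :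
      f.rangeRestrict.dualMap (LinearMap.lcomp R R (LinearMap.range f).subtype ψ) = f.dualMap ψ :=
    rfl
  have hinj : Function.Injective f.rangeRestrict.dualMap :=
    LinearMap.dualMap_injective_of_surjective f.surjective_rangeRestrict
  refine ⟨Submodule.mapQ _ _ f.rangeRestrict.dualMap ?_, Submodule.factor ?_, ?_, ?_, ?_⟩
  · rintro _ ⟨ψ, rfl⟩
    exact ⟨ψ, rfl⟩
  · rintro _ ⟨ψ, rfl⟩
    exact ⟨_, hcomp ψ⟩
  · rw [injective_iff_map_eq_zero]
    intro x hx
    obtain ⟨φ, rfl⟩ := Submodule.Quotient.mk_surjective _ x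
    obtain ⟨ψ, hψ⟩ := (Submodule.Quotient.mk_eq_zero _).1 hx
    exact (Submodule.Quotient.mk_eq_zero _).2 ⟨ψ, hinj hψ⟩
  · exact Submodule.factor_surjective _
  · intro x
    obtain ⟨φ, rfl⟩ := Submodule.Quotient.mk_surjective _ x
    constructor
    · intro hx
      obtain ⟨ψ, hψ⟩ := (Submodule.Quotient.mk_eq_zero _).1 hx
      exact ⟨Submodule.Quotient.mk ψ, congrArg Submodule.Quotient.mk hψ⟩
    · rintro ⟨y, hy⟩
      obtain ⟨ψ, rfl⟩ := Submodule.Quotient.mk_surjective _ y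
      rw [← hy]
      exact (Submodule.Quotient.mk_eq_zero _).2 ⟨ψ, rfl⟩

end dual

section resolution

variable {R : Type} [CommRing R] {M : Type} [AddCommGroup M] [Module R M]
  {F : ℕ → Type} [∀ i, AddCommGroup (F i)] [∀ i, Module R (F i)]
  {f : ∀ i : ℕ, F (i + 1) →ₗ[R] F i} {g : F 0 →ₗ[R] M} {d : ℕ}

lemma exact_subtype_of_range_eq {A B : Type} [AddCommGroup A] [Module R A] [AddCommGroup B]
    [Module R B] {K : Submodule R A} {φ : A →ₗ[R] B} (h : K = LinearMap.ker φ) :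
    Function.Exact K.subtype φ :=
  LinearMap.exact_iff.2 (by rw [Submodule.range_subtype, h])

lemma exact_subtype_rangeRestrict {m : ℕ}
    (h : LinearMap.range (f (m + 1)) = LinearMap.ker (f m)) :
    Function.Exact (LinearMap.range (f (m + 1))).subtype (f m).rangeRestrict :=
  exact_subtype_of_range_eq (by rw [h, LinearMap.ker_rangeRestrict])

lemma le_rdepth_quotient_range_dualMap [IsLocalRing R] (hR : (d : ℕ∞) ≤ rdepth R R)
    (hex : ∀ i : ℕ, i + 3 ≤ d → LinearMap.range (f (i + 1)) = LinearMap.ker (f i))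
    {m : ℕ} (hm : m + 2 ≤ d)
    (h : m + 3 ≤ d → ((d - (m + 1) : ℕ) : ℕ∞) ≤ rdepth R (LinearMap.range (f (m + 1)).dualMap)) :
    ((d - (m + 1) : ℕ) : ℕ∞) ≤
      rdepth R (Module.Dual R (F (m + 1)) ⧸ LinearMap.range (f m).rangeRestrict.dualMap) := by
  by_cases hm' : m + 3 ≤ d
  · obtain ⟨e⟩ := nonempty_quotient_range_dualMap_equiv (hex m hm')
    exact le_rdepth_of_equiv e.symm (h hm')
  · obtain ⟨e⟩ := nonempty_quotient_range_dualMap_equiv (f := f m) (Submodule.range_subtype _)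
    rw [show d - (m + 1) = 1 by omega]
    have h1 : ((1 : ℕ) : ℕ∞) ≤ rdepth R R := (Nat.cast_le.2 (by omega)).trans hR
    exact le_rdepth_of_equiv e.symm (one_le_rdepth_of_injective (Submodule.subtype_injective _)
      (one_le_rdepth_dual h1 _))

variable [∀ i, Module.Free R (F i)]

lemma nonempty_extMod_equiv_syzygy (hg : Function.Surjective g)
    (hfg : LinearMap.range (f 0) = LinearMap.ker g)
    (hex : ∀ i : ℕ, i + 3 ≤ d → LinearMap.range (f (i + 1)) = LinearMap.ker (f i))
    (N : Type) [AddCommGroup N] [Module R N] (m : ℕ) (hm : m + 2 ≤ d) (i : ℕ) :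
    Nonempty (extMod R M N (m + i + 2) ≃ₗ[R] extMod R (LinearMap.range (f m)) N (i + 1)) := by
  induction m generalizing i with
  | zero =>
    rw [zero_add]
    exact nonempty_extMod_succ_equiv N _ g (Submodule.subtype_injective _) hg
      (exact_subtype_of_range_eq hfg) i
  | succ m ih =>
    obtain ⟨e⟩ := ih (by omega) (i + 1)
    obtain ⟨e'⟩ := nonempty_extMod_succ_equiv N _ _ (Submodule.subtype_injective _)
      (f m).surjective_rangeRestrict (exact_subtype_rangeRestrict (hex m hm)) i
    rw [show m + 1 + i + 2 = m + (i + 1) + 2 by omega]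
    exact ⟨e.trans e'⟩

lemma nonempty_extMod_equiv_quotient (hg : Function.Surjective g)
    (hfg : LinearMap.range (f 0) = LinearMap.ker g)
    (hex : ∀ i : ℕ, i + 3 ≤ d → LinearMap.range (f (i + 1)) = LinearMap.ker (f i))
    (N : Type) [AddCommGroup N] [Module R N] (m : ℕ) (hm : m + 2 ≤ d) :
    Nonempty (extMod R M N (m + 1) ≃ₗ[R] ((LinearMap.range (f m) →ₗ[R] N) ⧸
      LinearMap.range (LinearMap.lcomp R N (LinearMap.range (f m)).subtype))) := by
  cases m with
  | zero =>
    exact nonempty_extMod_one_equiv N _ g (Submodule.subtype_injective _) hg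
      (exact_subtype_of_range_eq hfg)
  | succ m =>
    obtain ⟨e⟩ := nonempty_extMod_equiv_syzygy hg hfg hex N m (by omega) 0
    obtain ⟨e'⟩ := nonempty_extMod_one_equiv N _ _ (Submodule.subtype_injective _)
      (f m).surjective_rangeRestrict (exact_subtype_rangeRestrict (hex m hm))
    exact ⟨e.trans e'⟩

variable [IsLocalRing R]

lemma isSDE_iff (hg : Function.Surjective g)
    (hfg : LinearMap.range (f 0) = LinearMap.ker g)
    (hex : ∀ i : ℕ, i + 3 ≤ d → LinearMap.range (f (i + 1)) = LinearMap.ker (f i)) :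
    isSDE R M d ↔ ∀ m, m + 2 ≤ d → ((d - (m + 1) : ℕ) : ℕ∞) ≤
      rdepth R (Module.Dual R (LinearMap.range (f m)) ⧸
        LinearMap.range (LinearMap.lcomp R R (LinearMap.range (f m)).subtype)) := by
  constructor
  · intro h m hm
    obtain ⟨e⟩ := nonempty_extMod_equiv_quotient hg hfg hex R m hm
    refine le_rdepth_of_equiv e ?_
    rcases h (m + 1) (by omega) (by omega) with h | h
    · exact le_rdepth_of_subsingleton
    · exact h
  · rintro h (_ | m) h1 hm
    · omega
    · obtain ⟨e⟩ := nonempty_extMod_equiv_quotient hg hfg hex R m (by omega)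
      exact Or.inr (le_rdepth_of_equiv e.symm (h m (by omega)))

lemma le_rdepth_coker_dualMap_iff (hR : (d : ℕ∞) ≤ rdepth R R) {m : ℕ} (hm : m + 2 ≤ d) :
    ((d - (m + 1) : ℕ) : ℕ∞) ≤ rdepth R (Module.Dual R (F (m + 1)) ⧸
      LinearMap.range (f m).dualMap) ↔
    ((d - m : ℕ) : ℕ∞) ≤ rdepth R (LinearMap.range (f m).dualMap) := by
  have hP {n : ℕ} (hn : n ≤ d) : (n : ℕ∞) ≤ rdepth R (Module.Dual R (F (m + 1))) :=
    le_rdepth_dual_of_free ((Nat.cast_le.2 hn).trans hR) _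
  have hex : Function.Exact (LinearMap.range (f m).dualMap).subtype
      (LinearMap.range (f m).dualMap).mkQ := exact_subtype_of_range_eq (Submodule.ker_mkQ _).symm
  rw [show d - m = d - (m + 1) + 1 by omega]
  exact ⟨le_rdepth_left (Submodule.subtype_injective _) (Submodule.mkQ_surjective _) hex
      (hP (by omega)),
    le_rdepth_right (Submodule.subtype_injective _) (Submodule.mkQ_surjective _) hex
      (hP (by omega))⟩

lemma isSDE_iff_le_rdepth_coker_dualMap (hR : (d : ℕ∞) ≤ rdepth R R) (hg : Function.Surjective g)
    (hfg : LinearMap.range (f 0) = LinearMap.ker g)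
    (hex : ∀ i : ℕ, i + 3 ≤ d → LinearMap.range (f (i + 1)) = LinearMap.ker (f i)) :
    isSDE R M d ↔ ∀ m, m + 2 ≤ d → ((d - (m + 1) : ℕ) : ℕ∞) ≤
      rdepth R (Module.Dual R (F (m + 1)) ⧸ LinearMap.range (f m).dualMap) := by
  rw [isSDE_iff hg hfg hex]
  constructor
  · intro h
    have key (k : ℕ) : ∀ m, m + 2 + k = d → ((d - (m + 1) : ℕ) : ℕ∞) ≤
        rdepth R (Module.Dual R (F (m + 1)) ⧸ LinearMap.range (f m).dualMap) := by
      induction k with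
      | zero =>
        intro m hm
        obtain ⟨a, b, ha, hb, hab⟩ := exists_exact_dual (f m)
        exact le_rdepth_middle ha hb hab (h m (by omega))
          (le_rdepth_quotient_range_dualMap hR hex (by omega) fun _ => by omega)
      | succ k ih =>
        intro m hm
        obtain ⟨a, b, ha, hb, hab⟩ := exists_exact_dual (f m)
        exact le_rdepth_middle ha hb hab (h m (by omega))
          (le_rdepth_quotient_range_dualMap hR hex (by omega) fun _ =>
            (le_rdepth_coker_dualMap_iff hR (by omega)).1 (ih (m + 1) (by omega)))
    exact fun m hm => key (d - (m + 2)) m (by omega)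
  · intro h m hm
    obtain ⟨a, b, ha, hb, hab⟩ := exists_exact_dual (f m)
    have hC := le_rdepth_quotient_range_dualMap hR hex hm fun _ =>
      (le_rdepth_coker_dualMap_iff hR (by omega)).1 (h (m + 1) (by omega))
    have hT := h m hm
    rw [show d - (m + 1) = d - (m + 2) + 1 by omega] at hT hC ⊢
    exact le_rdepth_left ha hb hab hT ((Nat.cast_le.2 (Nat.le_succ _)).trans hC)

end resolution

/-- Over a Cohen-Macaulay Noetherian local ring of dimension `d ≥ 2`, given a
finite free resolution `F_{d-1} → ⋯ → F₁ → F₀ → M → 0` (here `f i : F (i+1) → F i` plays the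
role of `f_{i+1}`), `M` is SDE iff `depth 𝒯_i M ≥ d - i` for `1 ≤ i ≤ d-1`
(where `𝒯_{i+1} M = coker((f i)*) = Dual(F (i+1)) ⧸ range (f i)*`), iff
`depth λΩ^i M ≥ d - i` for `0 ≤ i ≤ d-2` (where `λΩ^i M = image((f i)*)`). -/
theorem statement3 (R : Type) [CommRing R] [IsNoetherianRing R] [IsLocalRing R]
    (d : ℕ) (hd : 2 ≤ d) (hR : isCMLocalRing R d)
    (M : Type) [AddCommGroup M] [Module R M] [Module.Finite R M]
    (F : ℕ → Type) [∀ i, AddCommGroup (F i)] [∀ i, Module R (F i)]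
    [∀ i, Module.Free R (F i)] [∀ i, Module.Finite R (F i)]
    (f : ∀ i : ℕ, F (i + 1) →ₗ[R] F i) (g : F 0 →ₗ[R] M)
    (hg : Function.Surjective g) (hfg : LinearMap.range (f 0) = LinearMap.ker g)
    (hex : ∀ i : ℕ, i + 3 ≤ d → LinearMap.range (f (i + 1)) = LinearMap.ker (f i)) :
    (isSDE R M d ↔ ∀ i : ℕ, i + 1 ≤ d - 1 →
        ((d - (i + 1) : ℕ) : ℕ∞) ≤
          rdepth R ((Module.Dual R (F (i + 1))) ⧸ LinearMap.range (f i).dualMap)) ∧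
    (isSDE R M d ↔ ∀ i : ℕ, i ≤ d - 2 →
        ((d - i : ℕ) : ℕ∞) ≤ rdepth R ↥(LinearMap.range (f i).dualMap)) := by
  have hd' (i : ℕ) : i + 1 ≤ d - 1 ↔ i + 2 ≤ d := by omega
  have hd'' (i : ℕ) : i ≤ d - 2 ↔ i + 2 ≤ d := by omega
  simp only [hd', hd'']
  have h := isSDE_iff_le_rdepth_coker_dualMap hR.2.ge hg hfg hex
  exact ⟨h, h.trans (forall₂_congr fun _ hm => le_rdepth_coker_dualMap_iff hR.2.ge hm)⟩
end
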